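/- arXiv:2412.04019 — 5 statements merged into one kernel-verified Lean document; each statement's English description precedes it below -/
import Mathlib

section
/- Under the stated setup, for every x in (e, t₁] one has g(x)^{1/(n−1)} ≤ g(e)^{1/(n−1)}·(v(x−e)/((n−1)g(e)) + 1); consequently g(x) ≤ h₀(x) for all x ∈ [t₀, t₁]. -/
open MeasureTheory Set Filter
open scoped ENNReal Pointwise

/-- Weighted arithmetic-geometric mean inequality for extended nonnegative reals. -/
theorem ENNReal.rpow_mul_rpow_le_arith_mean {s t : ℝ} (hs : 0 < s) (ht : 0 < t) (hst : s + t = 1)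
    (x y : ℝ≥0∞) : x ^ s * y ^ t ≤ ENNReal.ofReal s * x + ENNReal.ofReal t * y := by
  have hc : (s⁻¹).HolderConjugate t⁻¹ := by
    rw [Real.holderConjugate_iff]
    exact ⟨(one_lt_inv₀ hs).2 (by linarith), by simpa using hst⟩
  have h := ENNReal.young_inequality (x ^ s) (y ^ t) hc
  rw [← ENNReal.rpow_mul, ← ENNReal.rpow_mul, mul_inv_cancel₀ hs.ne', mul_inv_cancel₀ ht.ne',
    ENNReal.rpow_one, ENNReal.rpow_one, ENNReal.ofReal_inv_of_pos hs, ENNReal.ofReal_inv_of_pos ht,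
    div_eq_mul_inv, div_eq_mul_inv, inv_inv, inv_inv, mul_comm x, mul_comm y] at h
  exact h

/-- The Brunn-Minkowski inequality on the line, for compact sets. -/
theorem IsCompact.volume_add_le_of_add_subset {A B C : Set ℝ} (hA : IsCompact A)
    (hB : IsCompact B) (hA' : A.Nonempty) (hB' : B.Nonempty) (hC : A + B ⊆ C) :
    volume A + volume B ≤ volume C := by
  obtain ⟨a, haA, ha⟩ := hA.exists_isGreatest hA'
  obtain ⟨b, hbB, hb⟩ := hB.exists_isLeast hB'
  have hd : AEDisjoint volume ((fun x => b + x) '' A) ((fun x => a + x) '' B) := by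
    refine measure_mono_null (t := {a + b}) ?_ (by simp)
    rintro _ ⟨⟨x, hx, rfl⟩, ⟨y, hy, hxy⟩⟩
    have h1 := ha hx
    have h2 := hb hy
    simp only [mem_singleton_iff] at *
    linarith
  have hm : NullMeasurableSet ((fun x => a + x) '' B) volume :=
    (hB.image (by fun_prop)).measurableSet.nullMeasurableSet
  calc volume A + volume B
      = volume ((fun x => b + x) '' A) + volume ((fun x => a + x) '' B) := by simp
    _ = volume (((fun x => b + x) '' A) ∪ ((fun x => a + x) '' B)) := (measure_union₀ hm hd).symm
    _ ≤ volume C := by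
      refine measure_mono ?_
      rintro _ (⟨x, hx, rfl⟩ | ⟨y, hy, rfl⟩)
      · exact hC ⟨x, hx, b, hbB, add_comm _ _⟩
      · exact hC ⟨a, haA, y, hy, rfl⟩

/-- The Brunn-Minkowski inequality on the line, for measurable sets. -/
theorem MeasurableSet.volume_add_le_of_add_subset {A B C : Set ℝ} (hA : MeasurableSet A)
    (hB : MeasurableSet B) (hA' : A.Nonempty) (hB' : B.Nonempty) (hC : A + B ⊆ C) :
    volume A + volume B ≤ volume C := by
  obtain ⟨a, ha⟩ := hA'
  obtain ⟨b, hb⟩ := hB'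
  rw [hA.measure_eq_iSup_isCompact, hB.measure_eq_iSup_isCompact]
  simp only [iSup_and']
  refine ENNReal.biSup_add_biSup_le' ⟨∅, empty_subset _, isCompact_empty⟩
    ⟨∅, empty_subset _, isCompact_empty⟩ ?_
  rintro K ⟨hKA, hK⟩ L ⟨hLB, hL⟩
  calc volume K + volume L ≤ volume (insert a K) + volume (insert b L) := by
        gcongr <;> exact subset_insert _ _
    _ ≤ volume C := (hK.insert a).volume_add_le_of_add_subset (hL.insert b) ⟨a, by simp⟩
        ⟨b, by simp⟩ ((add_subset_add (insert_subset ha hKA) (insert_subset hb hLB)).trans hC)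

/-- Layer cake formula for an extended nonnegative function bounded by one. -/
theorem lintegral_eq_lintegral_meas_lt_of_le_one {α : Type*} [MeasurableSpace α] {μ : Measure α}
    {f : α → ℝ≥0∞} (hf : Measurable f) (hf1 : ∀ x, f x ≤ 1) :
    ∫⁻ x, f x ∂μ = ∫⁻ r in Ioi (0 : ℝ), μ {x | ENNReal.ofReal r < f x} := by
  have hfin : ∀ x, f x ≠ ∞ := fun x => ((hf1 x).trans_lt ENNReal.one_lt_top).ne
  have h := lintegral_eq_lintegral_meas_lt μ (f := fun x => (f x).toReal)
    (Eventually.of_forall fun _ => ENNReal.toReal_nonneg) hf.ennreal_toReal.aemeasurable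
  simp only [ENNReal.ofReal_toReal (hfin _)] at h
  rw [h]
  refine setLIntegral_congr_fun measurableSet_Ioi fun r hr => ?_
  simp only [ENNReal.ofReal_lt_iff_lt_toReal (le_of_lt hr) (hfin _)]

/-- The additive form of the Prékopa-Leindler inequality on the line, for functions with
supremum one. -/
theorem lintegral_add_le_of_iSup_eq_one {s t : ℝ} (hs : 0 < s) (ht : 0 < t) (hst : s + t = 1)
    {f g h : ℝ → ℝ≥0∞} (hf : Measurable f) (hg : Measurable g) (hh : Measurable h)
    (hf1 : ⨆ x, f x = 1) (hg1 : ⨆ x, g x = 1)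
    (hfgh : ∀ x y, f x ^ s * g y ^ t ≤ h (s * x + t * y)) :
    ENNReal.ofReal s * (∫⁻ x, f x) + ENNReal.ofReal t * ∫⁻ x, g x ≤ ∫⁻ x, h x := by
  have hfle : ∀ x, f x ≤ 1 := fun x => hf1 ▸ le_iSup f x
  have hgle : ∀ x, g x ≤ 1 := fun x => hg1 ▸ le_iSup g x
  have hanti : ∀ u : ℝ → ℝ≥0∞, Measurable fun r : ℝ => volume {x | ENNReal.ofReal r < u x} :=
    fun u => Antitone.measurable fun a b hab => measure_mono fun x hx =>
      (ENNReal.ofReal_le_ofReal hab).trans_lt hx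
  refine le_trans ?_ (lintegral_mono fun x => min_le_left (h x) 1)
  rw [lintegral_eq_lintegral_meas_lt_of_le_one hf hfle,
    lintegral_eq_lintegral_meas_lt_of_le_one hg hgle,
    lintegral_eq_lintegral_meas_lt_of_le_one (hh.min measurable_const) fun x => min_le_right _ _,
    ← lintegral_const_mul _ (hanti f), ← lintegral_const_mul _ (hanti g),
    ← lintegral_add_left ((hanti f).const_mul _)]
  refine setLIntegral_mono' measurableSet_Ioi fun r hr => ?_
  rcases le_or_gt 1 (ENNReal.ofReal r) with h1 | h1
  · simp [fun x => ((hfle x).trans h1).not_gt, fun x => ((hgle x).trans h1).not_gt]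
  have hscale : ∀ (c : ℝ) (A : Set ℝ), 0 < c → ENNReal.ofReal c * volume A = volume (c • A) := by
    intro c A hc
    simp [Measure.addHaar_smul, abs_of_pos hc]
  rw [hscale s _ hs, hscale t _ ht]
  refine MeasurableSet.volume_add_le_of_add_subset
    ((measurableSet_lt measurable_const hf).const_smul₀ _)
    ((measurableSet_lt measurable_const hg).const_smul₀ _) (Nonempty.smul_set ?_)
    (Nonempty.smul_set ?_) ?_
  · exact lt_iSup_iff.1 (hf1 ▸ h1)
  · exact lt_iSup_iff.1 (hg1 ▸ h1)
  · rintro _ ⟨_, ⟨x, hx, rfl⟩, _, ⟨y, hy, rfl⟩, rfl⟩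
    refine lt_min ?_ h1
    have hr0 : ENNReal.ofReal r ≠ 0 := by simpa using hr
    calc ENNReal.ofReal r = ENNReal.ofReal r ^ s * ENNReal.ofReal r ^ t := by
          rw [← ENNReal.rpow_add _ _ hr0 ENNReal.ofReal_ne_top, hst, ENNReal.rpow_one]
      _ < f x ^ s * g y ^ t := ENNReal.mul_lt_mul (ENNReal.rpow_lt_rpow hx hs)
          (ENNReal.rpow_lt_rpow hy ht)
      _ ≤ _ := hfgh x y

theorem prekopaLeindler_real_of_bounded {s t : ℝ} (hs : 0 < s) (ht : 0 < t) (hst : s + t = 1)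
    {f g h : ℝ → ℝ≥0∞} (hf : Measurable f) (hg : Measurable g) (hh : Measurable h)
    (hf1 : ⨆ x, f x ≠ ∞) (hg1 : ⨆ x, g x ≠ ∞)
    (hfgh : ∀ x y, f x ^ s * g y ^ t ≤ h (s * x + t * y)) :
    (∫⁻ x, f x) ^ s * (∫⁻ x, g x) ^ t ≤ ∫⁻ x, h x := by
  set a := ⨆ x, f x with ha
  set b := ⨆ x, g x with hb
  rcases eq_or_ne a 0 with ha0 | ha0
  · have : ∀ x, f x = 0 := by simpa [ha] using ha0
    simp [this, hs]
  rcases eq_or_ne b 0 with hb0 | hb0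
  · have : ∀ x, g x = 0 := by simpa [hb] using hb0
    simp [this, ht]
  have hc0 : a ^ s * b ^ t ≠ 0 := by simp [ha0, hb0, hf1, hg1]
  have hctop : a ^ s * b ^ t ≠ ∞ := ENNReal.mul_ne_top
    (ENNReal.rpow_ne_top_of_nonneg hs.le hf1) (ENNReal.rpow_ne_top_of_nonneg ht.le hg1)
  have hdiv : ∀ x y : ℝ≥0∞, (a⁻¹ * x) ^ s * (b⁻¹ * y) ^ t
      = (a ^ s * b ^ t)⁻¹ * (x ^ s * y ^ t) := by
    intro x y
    rw [ENNReal.mul_rpow_of_nonneg _ _ hs.le, ENNReal.mul_rpow_of_nonneg _ _ ht.le,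
      ENNReal.inv_rpow, ENNReal.inv_rpow, ENNReal.mul_inv (by simp [hb0, hg1])
        (by simp [ha0, hf1])]
    ring
  have key := lintegral_add_le_of_iSup_eq_one hs ht hst (hf.const_mul a⁻¹) (hg.const_mul b⁻¹)
    (hh.const_mul (a ^ s * b ^ t)⁻¹)
    (by rw [← ENNReal.mul_iSup, ENNReal.inv_mul_cancel ha0 hf1])
    (by rw [← ENNReal.mul_iSup, ENNReal.inv_mul_cancel hb0 hg1])
    (fun x y => by rw [hdiv]; gcongr; exact hfgh x y)
  have := (ENNReal.rpow_mul_rpow_le_arith_mean hs ht hst _ _).trans key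
  rw [lintegral_const_mul _ hf, lintegral_const_mul _ hg, lintegral_const_mul _ hh, hdiv] at this
  exact (ENNReal.mul_le_mul_iff_right (ENNReal.inv_ne_zero.2 hctop)
    (ENNReal.inv_ne_top.2 hc0)).1 this

theorem lintegral_eq_iSup_lintegral_min_natCast {α : Type*} [MeasurableSpace α] {μ : Measure α}
    {f : α → ℝ≥0∞} (hf : Measurable f) :
    ∫⁻ x, f x ∂μ = ⨆ N : ℕ, ∫⁻ x, min (f x) N ∂μ := by
  rw [← lintegral_iSup (fun N => hf.min measurable_const)
    fun N M hNM x => min_le_min_left _ (Nat.cast_le.2 hNM)]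
  refine lintegral_congr fun x => ?_
  rw [← inf_iSup_eq, ENNReal.iSup_natCast, inf_top_eq]

/-- The Prékopa-Leindler inequality on the line. -/
theorem prekopaLeindler_real {s t : ℝ} (hs : 0 < s) (ht : 0 < t) (hst : s + t = 1)
    {f g h : ℝ → ℝ≥0∞} (hf : Measurable f) (hg : Measurable g) (hh : Measurable h)
    (hfgh : ∀ x y, f x ^ s * g y ^ t ≤ h (s * x + t * y)) :
    (∫⁻ x, f x) ^ s * (∫⁻ x, g x) ^ t ≤ ∫⁻ x, h x := by
  have hpow : ∀ {c : ℝ} (_ : 0 < c) (u : ℕ → ℝ≥0∞), (⨆ N, u N) ^ c = ⨆ N, u N ^ c :=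
    fun hc u => (ENNReal.orderIsoRpow _ hc).map_iSup u
  rw [lintegral_eq_iSup_lintegral_min_natCast hf, lintegral_eq_iSup_lintegral_min_natCast hg,
    hpow hs, hpow ht]
  simp only [ENNReal.iSup_mul, ENNReal.mul_iSup, iSup_le_iff]
  intro N M
  have hfin : ∀ (u : ℝ → ℝ≥0∞) (N : ℕ), ⨆ x, min (u x) (N : ℝ≥0∞) ≠ ∞ := fun u N =>
    ((iSup_le fun x => min_le_right _ _).trans_lt (ENNReal.natCast_lt_top N)).ne
  refine prekopaLeindler_real_of_bounded hs ht hst (hf.min measurable_const)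
    (hg.min measurable_const) hh (hfin f _) (hfin g _) fun x y => (hfgh x y).trans' ?_
  gcongr <;> exact min_le_left _ _

theorem lintegral_fin_succ {m : ℕ} {f : (Fin (m + 1) → ℝ) → ℝ≥0∞} (hf : Measurable f) :
    ∫⁻ x, f x = ∫⁻ a : ℝ, ∫⁻ y : Fin m → ℝ, f (Fin.cons a y) := by
  have hmp := (volume_preserving_piFinSuccAbove (fun _ : Fin (m + 1) => ℝ) 0).symm
  rw [← hmp.lintegral_comp hf, Measure.volume_eq_prod, lintegral_prod]
  · simp [MeasurableEquiv.piFinSuccAbove, Fin.insertNthEquiv]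
  · exact (hf.comp (MeasurableEquiv.measurable _)).aemeasurable

/-- The Prékopa-Leindler inequality. -/
theorem prekopaLeindler {s t : ℝ} (hs : 0 < s) (ht : 0 < t) (hst : s + t = 1) (m : ℕ)
    {f g h : (Fin m → ℝ) → ℝ≥0∞} (hf : Measurable f) (hg : Measurable g) (hh : Measurable h)
    (hfgh : ∀ x y, f x ^ s * g y ^ t ≤ h (s • x + t • y)) :
    (∫⁻ x, f x) ^ s * (∫⁻ x, g x) ^ t ≤ ∫⁻ x, h x := by
  induction m with
  | zero =>
    rw [lintegral_unique, lintegral_unique, lintegral_unique]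
    rw [show volume (univ : Set (Fin 0 → ℝ)) = 1 by simp [volume_pi], mul_one, mul_one, mul_one]
    exact (hfgh _ _).trans_eq (congrArg h (Subsingleton.elim _ _))
  | succ m ih =>
    have hcons : Measurable fun p : ℝ × (Fin m → ℝ) => (Fin.cons p.1 p.2 : Fin (m + 1) → ℝ) :=
      measurable_pi_iff.2 (Fin.cases measurable_fst fun j =>
        (measurable_pi_apply j).comp measurable_snd)
    rw [lintegral_fin_succ hf, lintegral_fin_succ hg, lintegral_fin_succ hh]
    refine prekopaLeindler_real hs ht hst (hf.comp hcons).lintegral_prod_right'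
      (hg.comp hcons).lintegral_prod_right' (hh.comp hcons).lintegral_prod_right' fun a b => ?_
    refine ih (hf.comp (hcons.comp measurable_prodMk_left))
      (hg.comp (hcons.comp measurable_prodMk_left))
      (hh.comp (hcons.comp measurable_prodMk_left)) fun x y => ?_
    have hxy : s • (Fin.cons a x : Fin (m + 1) → ℝ) + t • (Fin.cons b y : Fin (m + 1) → ℝ)
        = Fin.cons (s * a + t * b) (s • x + t • y) := by
      ext i
      refine Fin.cases ?_ (fun j => ?_) i <;> simp
    simpa [hxy] using hfgh (Fin.cons a x) (Fin.cons b y)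

/-- The Brunn-Minkowski inequality for measurable sets, in multiplicative form. -/
theorem volume_rpow_mul_volume_rpow_le {s t : ℝ} (hs : 0 < s) (ht : 0 < t) (hst : s + t = 1)
    {m : ℕ} {A B C : Set (Fin m → ℝ)} (hA : MeasurableSet A) (hB : MeasurableSet B)
    (hC : MeasurableSet C) (hABC : s • A + t • B ⊆ C) :
    volume A ^ s * volume B ^ t ≤ volume C := by
  have h := prekopaLeindler hs ht hst m (f := A.indicator 1) (g := B.indicator 1)
    (h := C.indicator 1) (measurable_one.indicator hA) (measurable_one.indicator hB)
    (measurable_one.indicator hC) fun x y => by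
      by_cases hx : x ∈ A
      · by_cases hy : y ∈ B
        · have : s • x + t • y ∈ C := hABC (add_mem_add (smul_mem_smul_set hx)
            (smul_mem_smul_set hy))
          simp [hx, hy, this]
        · simp [hy, ht]
      · simp [hx, hs]
  simpa [lintegral_indicator_one, hA, hB, hC] using h

/-- The Brunn-Minkowski inequality for compact sets. -/
theorem IsCompact.brunnMinkowski {s t : ℝ} (hs : 0 < s) (ht : 0 < t)
    {m : ℕ} (hm : m ≠ 0) {A B C : Set (Fin m → ℝ)} (hA : IsCompact A) (hB : IsCompact B)
    (hC : IsCompact C) (hA' : A.Nonempty) (hB' : B.Nonempty) (hABC : s • A + t • B ⊆ C) :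
    s * (volume A).toReal ^ (1 / m : ℝ) + t * (volume B).toReal ^ (1 / m : ℝ)
      ≤ (volume C).toReal ^ (1 / m : ℝ) := by
  have hm0 : (0 : ℝ) < m := by positivity
  have hone : (1 / m : ℝ) ≠ 0 := by positivity
  have hroot : ∀ {c : ℝ} {K : Set (Fin m → ℝ)}, 0 < c →
      (volume (c • K)).toReal ^ (1 / m : ℝ) = c * (volume K).toReal ^ (1 / m : ℝ) := by
    intro c K hc
    rw [Measure.addHaar_smul, ENNReal.toReal_mul, ENNReal.toReal_ofReal (abs_nonneg _),
      Module.finrank_fin_fun, abs_of_pos (by positivity),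
      Real.mul_rpow (by positivity) ENNReal.toReal_nonneg, one_div,
      Real.pow_rpow_inv_natCast hc.le hm]
  have hmono : ∀ {K : Set (Fin m → ℝ)}, K ⊆ C → (volume K).toReal ^ (1 / m : ℝ)
      ≤ (volume C).toReal ^ (1 / m : ℝ) := fun hK =>
    Real.rpow_le_rpow ENNReal.toReal_nonneg
      (ENNReal.toReal_mono hC.measure_ne_top (measure_mono hK)) (by positivity)
  set a := (volume A).toReal ^ (1 / m : ℝ) with ha
  set b := (volume B).toReal ^ (1 / m : ℝ) with hb
  have ha_nonneg : 0 ≤ a := by positivity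
  have hb_nonneg : 0 ≤ b := by positivity
  rcases ha_nonneg.eq_or_lt with ha0 | ha0
  · obtain ⟨x, hx⟩ := hA'
    rw [← ha0, mul_zero, zero_add, hb, ← hroot ht]
    refine le_trans (le_of_eq ?_) (hmono (K := (s • x) +ᵥ (t • B)) ?_)
    · rw [measure_vadd]
    · rintro _ ⟨y, hy, rfl⟩
      exact hABC (add_mem_add (smul_mem_smul_set hx) hy)
  rcases hb_nonneg.eq_or_lt with hb0 | hb0
  · obtain ⟨y, hy⟩ := hB'
    rw [← hb0, mul_zero, add_zero, ha, ← hroot hs]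
    refine le_trans (le_of_eq ?_) (hmono (K := (t • y) +ᵥ (s • A)) ?_)
    · rw [measure_vadd]
    · rintro _ ⟨x, hx, rfl⟩
      exact hABC ⟨x, hx, t • y, smul_mem_smul_set hy, add_comm _ _⟩
  have hc : 0 < s * a + t * b := by positivity
  have hunit : ∀ {K : Set (Fin m → ℝ)} {c : ℝ}, 0 < c →
      c = (volume K).toReal ^ (1 / m : ℝ) → volume (c⁻¹ • K) = 1 := by
    intro K c hc hcK
    have h1 := hroot (K := K) (inv_pos.2 hc)
    rw [← hcK, inv_mul_cancel₀ hc.ne'] at h1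
    exact (ENNReal.toReal_eq_one_iff _).1 <| (Real.rpow_left_inj ENNReal.toReal_nonneg
      zero_le_one hone).1 (h1.trans (Real.one_rpow _).symm)
  have hsub : (s * a / (s * a + t * b)) • (a⁻¹ • A) + (t * b / (s * a + t * b)) • (b⁻¹ • B)
      ⊆ (s * a + t * b)⁻¹ • C := by
    rw [smul_smul, smul_smul, show s * a / (s * a + t * b) * a⁻¹ = (s * a + t * b)⁻¹ * s by
      field_simp, show t * b / (s * a + t * b) * b⁻¹ = (s * a + t * b)⁻¹ * t by field_simp,
      ← smul_smul, ← smul_smul, ← smul_add]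
    exact smul_set_mono hABC
  have key := volume_rpow_mul_volume_rpow_le (by positivity) (by positivity)
    (by rw [← add_div, div_self hc.ne']) (hA.smul _).measurableSet (hB.smul _).measurableSet
    (hC.smul _).measurableSet hsub
  rw [hunit ha0 ha, hunit hb0 hb, ENNReal.one_rpow, ENNReal.one_rpow, one_mul] at key
  have h1 : 1 ≤ (volume ((s * a + t * b)⁻¹ • C)).toReal ^ (1 / m : ℝ) :=
    Real.one_le_rpow (by simpa using ENNReal.toReal_mono (hC.smul _).measure_ne_top key)
      (by positivity)
  rwa [hroot (inv_pos.2 hc), ← div_eq_inv_mul, one_le_div hc] at h1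

/-- A one-sided derivative of a concave function, from either side, bounds the slope of every
chord to the right. -/
theorem ConcaveOn.slope_le_of_hasDerivWithinAt_of_notMem {S u : Set ℝ} {f : ℝ → ℝ} {f' x y : ℝ}
    (hf : ConcaveOn ℝ S f) (hx : S ∈ nhds x) (hy : y ∈ S) (hxy : x < y) (hxu : x ∉ u)
    [(nhdsWithin x u).NeBot] (hf' : HasDerivWithinAt f f' u x) : slope f x y ≤ f' := by
  refine ge_of_tendsto ((hasDerivWithinAt_iff_tendsto_slope' hxu).1 hf') ?_
  filter_upwards [nhdsWithin_le_nhds hx, nhdsWithin_le_nhds (Iio_mem_nhds hxy),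
    self_mem_nhdsWithin] with z hzS hzy hzu
  exact hf.slope_anti (mem_of_mem_nhds hx) ⟨hzS, fun h => hxu (h ▸ hzu)⟩ ⟨hy, hxy.ne'⟩ hzy.le

/-- Brunn's theorem: the normalized volume of the slices of a compact convex set is concave. -/
theorem IsCompact.concaveOn_volume_slice_rpow {m : ℕ} (hm : m ≠ 0)
    {Δ : Set (ℝ × (Fin m → ℝ))} (hΔ : IsCompact Δ) (hconv : Convex ℝ Δ) :
    ConcaveOn ℝ (Prod.fst '' Δ)
      fun x => (volume {y : Fin m → ℝ | (x, y) ∈ Δ}).toReal ^ (1 / m : ℝ) := by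
  have hcomp : ∀ x, IsCompact {y : Fin m → ℝ | (x, y) ∈ Δ} := fun x =>
    (hΔ.image continuous_snd).of_isClosed_subset (hΔ.isClosed.preimage (by fun_prop))
      fun y hy => ⟨_, hy, rfl⟩
  refine concaveOn_iff_forall_pos.2 ⟨hconv.linear_image (LinearMap.fst ℝ ℝ (Fin m → ℝ)), ?_⟩
  rintro _ ⟨⟨x, p⟩, hp, rfl⟩ _ ⟨⟨y, q⟩, hq, rfl⟩ s t hs ht hst
  refine IsCompact.brunnMinkowski hs ht hm (hcomp x) (hcomp y) (hcomp _) ⟨p, hp⟩ ⟨q, hq⟩ ?_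
  rintro _ ⟨_, ⟨z, hz, rfl⟩, _, ⟨w, hw, rfl⟩, rfl⟩
  exact hconv hz hw hs.le ht.le hst

/-- A set with nonempty interior has a slice of positive volume. -/
theorem exists_volume_slice_pos {m : ℕ} {Δ : Set (ℝ × (Fin m → ℝ))} (hΔ : (interior Δ).Nonempty) :
    ∃ x ∈ Prod.fst '' Δ, 0 < volume {y : Fin m → ℝ | (x, y) ∈ Δ} := by
  obtain ⟨⟨x, y⟩, hxy⟩ := hΔ
  refine ⟨x, ⟨_, interior_subset hxy, rfl⟩, Measure.measure_pos_of_mem_nhds _ (x := y) ?_⟩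
  exact (Continuous.prodMk_right x).continuousAt.preimage_mem_nhds (mem_interior_iff_mem_nhds.1 hxy)

/-- A nonnegative concave function that is positive somewhere is positive in the interior. -/
theorem ConcaveOn.pos_of_mem_interior {S : Set ℝ} {f : ℝ → ℝ} {x z : ℝ} (hf : ConcaveOn ℝ S f)
    (hf0 : ∀ y ∈ S, 0 ≤ f y) (hx : x ∈ interior S) (hz : z ∈ S) (hfz : 0 < f z) : 0 < f x := by
  have hev : ∀ᶠ c : ℝ in nhdsWithin 0 (Ioi 0), x + c * (x - z) ∈ S := by
    have : ContinuousAt (fun c : ℝ => x + c * (x - z)) 0 := by fun_prop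
    exact nhdsWithin_le_nhds (this.preimage_mem_nhds
      (by simpa using mem_interior_iff_mem_nhds.1 hx))
  obtain ⟨c, hcS, hc⟩ := (hev.and self_mem_nhdsWithin).exists
  have hc : 0 < c := hc
  obtain ⟨-, hf⟩ := hf
  have h := @hf z hz _ hcS (c / (1 + c)) (1 / (1 + c)) (by positivity) (by positivity)
    (by field_simp; ring)
  have hx' : (c / (1 + c)) • z + (1 / (1 + c)) • (x + c * (x - z)) = x := by
    simp only [smul_eq_mul]; field_simp; ring
  rw [hx'] at h
  have := hf0 _ hcS
  exact lt_of_lt_of_le (by simp only [smul_eq_mul]; positivity) h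

theorem stmt_0
    (n : ℕ) (hn : 2 ≤ n)
    (Δ : Set (ℝ × (Fin (n - 1) → ℝ)))
    (hΔcomp : IsCompact Δ) (hΔconv : Convex ℝ Δ)
    (hΔint : (interior Δ).Nonempty)
    (t₀ t₁ : ℝ) (hproj : Prod.fst '' Δ = Icc t₀ t₁)
    (V : ℝ) (hV : V = (volume Δ).toReal)
    (b₁ : ℝ) (hb₁ : b₁ = (1 / V) * ∫ p in Δ, p.1)
    (g : ℝ → ℝ)
    (hg : ∀ x : ℝ, g x = (volume {y : Fin (n - 1) → ℝ | (x, y) ∈ Δ}).toReal)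
    (e : ℝ) (he : e ∈ Ioo t₀ t₁)
    (v : ℝ)
    (hv : Tendsto (fun x => (g x - g e) / (x - e)) (nhdsWithin e (Ioi e)) (nhds v)
        ∨ Tendsto (fun x => (g x - g e) / (x - e)) (nhdsWithin e (Iio e)) (nhds v))
    (h₀ : ℝ → ℝ)
    (hh₀ : ∀ x ∈ Icc t₀ e, h₀ x = g x)
    (hh₀' : ∀ x ∈ Icc e t₁,
      h₀ x = g e * (v * (x - e) / (((n : ℝ) - 1) * g e) + 1) ^ (n - 1)) :
    (∀ x ∈ Ioc e t₁,
      g x ^ ((1 : ℝ) / ((n : ℝ) - 1))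
        ≤ g e ^ ((1 : ℝ) / ((n : ℝ) - 1)) * (v * (x - e) / (((n : ℝ) - 1) * g e) + 1))
    ∧ ∀ x ∈ Icc t₀ t₁, g x ≤ h₀ x := by
  have hm : n - 1 ≠ 0 := by omega
  have hcast : (n : ℝ) - 1 = (n - 1 : ℕ) := by push_cast [show 1 ≤ n by omega]; rfl
  simp only [hcast] at hh₀' ⊢
  clear hcast
  generalize n - 1 = m at *
  have hm0 : (0 : ℝ) < m := by positivity
  have hg0 : ∀ x, 0 ≤ g x := fun x => hg x ▸ ENNReal.toReal_nonneg
  have hconc : ConcaveOn ℝ (Icc t₀ t₁) fun x => g x ^ (1 / m : ℝ) := by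
    simpa only [hproj, hg] using hΔcomp.concaveOn_volume_slice_rpow hm hΔconv
  have hge : 0 < g e := by
    obtain ⟨z, hz, hzpos⟩ := exists_volume_slice_pos hΔint
    have hztop : volume {y : Fin m → ℝ | (z, y) ∈ Δ} ≠ ⊤ :=
      ((hΔcomp.image continuous_snd).measure_lt_top.trans_le' <|
        measure_mono fun y hy => ⟨(z, y), hy, rfl⟩).ne
    have hgz : 0 < g z := hg z ▸ ENNReal.toReal_pos hzpos.ne' hztop
    have := hconc.pos_of_mem_interior (fun y _ => Real.rpow_nonneg (hg0 y) _)
      (by rwa [interior_Icc]) (hproj ▸ hz) (Real.rpow_pos_of_pos hgz _)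
    refine (hg0 e).lt_of_ne fun h => ?_
    rw [← h, Real.zero_rpow (by positivity)] at this
    exact this.false
  have hroot : ∀ x ∈ Ioc e t₁, g x ^ (1 / m : ℝ)
      ≤ g e ^ (1 / m : ℝ) * (v * (x - e) / (m * g e) + 1) := by
    intro x hx
    have hxS : x ∈ Icc t₀ t₁ := ⟨(he.1.trans hx.1).le, hx.2⟩
    have hslope : slope (fun x => g x ^ (1 / m : ℝ)) e x
        ≤ v * (1 / m : ℝ) * g e ^ ((1 / m : ℝ) - 1) := by
      have hdiv : (fun x => (g x - g e) / (x - e)) = slope g e := by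
        ext; rw [slope_def_field]
      rw [hdiv] at hv
      rcases hv with hv | hv
      · exact hconc.slope_le_of_hasDerivWithinAt_of_notMem (Icc_mem_nhds he.1 he.2) hxS hx.1
          self_notMem_Ioi (((hasDerivWithinAt_iff_tendsto_slope' self_notMem_Ioi).2 hv).rpow_const
            (Or.inl hge.ne'))
      · exact hconc.slope_le_of_hasDerivWithinAt_of_notMem (Icc_mem_nhds he.1 he.2) hxS hx.1
          self_notMem_Iio (((hasDerivWithinAt_iff_tendsto_slope' self_notMem_Iio).2 hv).rpow_const
            (Or.inl hge.ne'))
    rw [slope_def_field, div_le_iff₀ (sub_pos.2 hx.1), Real.rpow_sub_one hge.ne',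
      sub_le_iff_le_add] at hslope
    refine hslope.trans_eq ?_
    field_simp
  refine ⟨hroot, fun x hx => ?_⟩
  rcases le_or_gt x e with hxe | hxe
  · exact (hh₀ x ⟨hx.1, hxe⟩).ge
  rw [hh₀' x ⟨hxe.le, hx.2⟩]
  have h := pow_le_pow_left₀ (Real.rpow_nonneg (hg0 x) _) (hroot x ⟨hxe, hx.2⟩) m
  rwa [mul_pow, one_div, Real.rpow_inv_natCast_pow (hg0 x) hm,
    Real.rpow_inv_natCast_pow (hg0 e) hm] at h
end

section
/- Under the stated setup, for every x in the open interval (e, t₁) one has v(x−e)/((n−1)g(e)) + 1 > 0. -/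
open MeasureTheory Set Filter

/-- Sections of a convex set shrink at most like those of a cone when moving towards a point. -/
theorem Convex.pow_mul_volume_section_le {m : ℕ} {Δ : Set (ℝ × (Fin m → ℝ))} (hconv : Convex ℝ Δ)
    (hcomp : IsCompact Δ) {s : ℝ} {q : Fin m → ℝ} (hs : (s, q) ∈ Δ) {x z : ℝ}
    (hxz : x ≤ z) (hzs : z < s) :
    ((s - z) / (s - x)) ^ m * (volume {y : Fin m → ℝ | (x, y) ∈ Δ}).toReal
      ≤ (volume {y : Fin m → ℝ | (z, y) ∈ Δ}).toReal := by
  have hsx : 0 < s - x := by linarith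
  have hc : 0 ≤ (s - z) / (s - x) := div_nonneg (by linarith) hsx.le
  have hsub : AffineMap.homothety q ((s - z) / (s - x)) '' {y : Fin m → ℝ | (x, y) ∈ Δ}
      ⊆ {y : Fin m → ℝ | (z, y) ∈ Δ} := by
    rintro _ ⟨y, hy, rfl⟩
    have h := hconv hy hs hc (div_nonneg (sub_nonneg.2 hxz) hsx.le)
      (by field_simp; ring)
    have heq : ((s - z) / (s - x)) • (x, y) + ((z - x) / (s - x)) • (s, q)
        = (z, AffineMap.homothety q ((s - z) / (s - x)) y) := by
      ext i
      · simp
        field_simp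
        ring
      · simp [AffineMap.homothety_apply]
        field_simp
        ring
    rwa [heq] at h
  have hfin : volume {y : Fin m → ℝ | (z, y) ∈ Δ} ≠ ⊤ := by
    refine ((measure_mono ?_).trans_lt (hcomp.image continuous_snd).measure_lt_top).ne
    exact fun y hy => ⟨_, hy, rfl⟩
  have h := ENNReal.toReal_mono hfin (measure_mono hsub)
  rw [Measure.addHaar_image_homothety, ENNReal.toReal_mul, Module.finrank_fin_fun,
    abs_of_nonneg (pow_nonneg hc m), ENNReal.toReal_ofReal (pow_nonneg hc m)] at h
  exact h

theorem stmt_1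
    (n : ℕ) (hn : 2 ≤ n)
    (Δ : Set (ℝ × (Fin (n - 1) → ℝ)))
    (hΔcomp : IsCompact Δ) (hΔconv : Convex ℝ Δ)
    (hΔint : (interior Δ).Nonempty)
    (t₀ t₁ : ℝ) (hproj : Prod.fst '' Δ = Icc t₀ t₁)
    (V : ℝ) (hV : V = (volume Δ).toReal)
    (b₁ : ℝ) (hb₁ : b₁ = (1 / V) * ∫ p in Δ, p.1)
    (g : ℝ → ℝ)
    (hg : ∀ x : ℝ, g x = (volume {y : Fin (n - 1) → ℝ | (x, y) ∈ Δ}).toReal)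
    (e : ℝ) (he : e ∈ Ioo t₀ t₁)
    (v : ℝ)
    (hv : Tendsto (fun x => (g x - g e) / (x - e)) (nhdsWithin e (Ioi e)) (nhds v)
        ∨ Tendsto (fun x => (g x - g e) / (x - e)) (nhdsWithin e (Iio e)) (nhds v)) :
    ∀ x ∈ Ioo e t₁, 0 < v * (x - e) / (((n : ℝ) - 1) * g e) + 1 := by
  intro x hx
  obtain ⟨he₀, he₁⟩ := he
  obtain ⟨hex, hxt⟩ := hx
  have hd : 0 < t₁ - e := by linarith
  have hn1 : ((n - 1 : ℕ) : ℝ) = (n : ℝ) - 1 := by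
    rw [Nat.cast_sub (by omega), Nat.cast_one]
  have hn0 : 0 < (n : ℝ) - 1 := by
    have : (2 : ℝ) ≤ n := by exact_mod_cast hn
    linarith
  have hge : 0 ≤ g e := by rw [hg]; exact ENNReal.toReal_nonneg
  rcases hge.eq_or_lt with h0 | hpos
  · simp [← h0]
  obtain ⟨⟨s, q⟩, hq, rfl⟩ : t₁ ∈ Prod.fst '' Δ := by
    rw [hproj]
    exact right_mem_Icc.2 (by linarith)
  dsimp only at hproj hxt he₁ hd
  -- The cone over the section at `e` with apex `(s, q)` has section volume `φ`.
  set φ : ℝ → ℝ := fun x => ((s - x) / (s - e)) ^ (n - 1) * g e with hφ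
  have hφe : φ e = g e := by simp [hφ, hd.ne']
  have hder : HasDerivAt φ (-(((n : ℝ) - 1) * g e / (s - e))) e := by
    have h := ((((hasDerivAt_id e).const_sub s).div_const (s - e)).pow (n - 1)).mul_const (g e)
    refine HasDerivAt.congr_deriv h ?_
    simp only [id, div_self hd.ne', one_pow, hn1]
    ring
  have hslope := hasDerivAt_iff_tendsto_slope.1 hder
  have hright : ∀ᶠ y in nhdsWithin e (Ioi e), slope φ e y ≤ (g y - g e) / (y - e) := by
    filter_upwards [Ioo_mem_nhdsGT he₁] with y hy
    have h := hΔconv.pow_mul_volume_section_le hΔcomp hq hy.1.le hy.2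
    rw [← hg, ← hg] at h
    rw [slope_def_field, hφe]
    exact div_le_div_of_nonneg_right (by simpa [hφ] using h) (by linarith [hy.1])
  have hleft : ∀ᶠ y in nhdsWithin e (Iio e), slope φ e y ≤ (g y - g e) / (y - e) := by
    filter_upwards [self_mem_nhdsWithin] with y hy
    have hy : y < e := hy
    have h := hΔconv.pow_mul_volume_section_le hΔcomp hq hy.le he₁
    rw [← hg, ← hg] at h
    have hsy : 0 < s - y := by linarith
    have h' : g y ≤ φ y := by
      have hmul := mul_le_mul_of_nonneg_left h (pow_nonneg (div_pos hsy hd).le (n - 1))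
      rwa [← mul_assoc, ← mul_pow, div_mul_div_cancel₀ hd.ne', div_self hsy.ne', one_pow,
        one_mul] at hmul
    rw [slope_def_field, hφe]
    exact div_le_div_of_nonpos_of_le (by linarith) (by linarith)
  have hv' : -(((n : ℝ) - 1) * g e / (s - e)) ≤ v := by
    rcases hv with hv | hv
    · exact le_of_tendsto_of_tendsto
        (hslope.mono_left (nhdsGT_le_nhdsNE e)) hv hright
    · exact le_of_tendsto_of_tendsto
        (hslope.mono_left (nhdsLT_le_nhdsNE e)) hv hleft
  have hD : 0 < ((n : ℝ) - 1) * g e := mul_pos hn0 hpos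
  rw [← neg_lt_iff_pos_add, lt_div_iff₀ hD]
  have hbound := mul_le_mul_of_nonneg_right hv' (sub_pos.2 hex).le
  refine lt_of_lt_of_le ?_ hbound
  rw [neg_mul, neg_mul, neg_lt_neg_iff, one_mul, div_mul_eq_mul_div, div_lt_iff₀ hd]
  exact mul_lt_mul_of_pos_left (by linarith) hD
end

section
/- Under the stated setup, the first coordinate of the barycenter satisfies b₁ ≥ (1/V)·∫_{t₀}^{s₀} x·h₀(x) dx, where s₀ = e + ((n−1)g(e)/v)·( ( (n·v·(V − ∫_{t₀}^{e} g(x)dx) + (n−1)g(e)²) / ((n−1)g(e)²) )^{1/n} − 1 ) if v ≠ 0, and s₀ = e + (1/g(e))·(V − ∫_{t₀}^{e} g(x)dx) if v = 0. -/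
open MeasureTheory Set Filter

section BrunnMinkowski

open scoped ENNReal Pointwise

theorem volume_add_le_of_compact_real {a b : ℝ} (ha : 0 < a) (hb : 0 < b) {K L C : Set ℝ}
    (hK : IsCompact K) (hL : IsCompact L) (hKn : K.Nonempty) (hLn : L.Nonempty)
    (hC : ∀ x ∈ K, ∀ y ∈ L, a * x + b * y ∈ C) :
    ENNReal.ofReal a * volume K + ENNReal.ofReal b * volume L ≤ volume C := by
  obtain ⟨k, hk, hkmax⟩ := hK.exists_isGreatest hKn
  obtain ⟨l, hl, hlmin⟩ := hL.exists_isLeast hLn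
  set c := a * k + b * l
  have hvol : ∀ (r s : ℝ) (S : Set ℝ), 0 < r →
      volume ((fun x => s + r • x) '' S) = ENNReal.ofReal r * volume S := by
    intro r s S hr
    have : (fun x => s + r • x) '' S = (fun x => s + x) '' (r • S) := by
      rw [← image_smul, image_image]
    rw [this, image_add_left, measure_preimage_add, Measure.addHaar_smul_of_nonneg _ hr.le]
    simp
  rw [← hvol a (b * l) K ha, ← hvol b (a * k) L hb,
    ← measure_inter_add_sdiff C (measurableSet_Iio (a := c))]
  refine add_le_add ?_ ?_
  · rw [← measure_sdiff_null (s := (fun x => b * l + a • x) '' K) (measure_singleton c)]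
    refine measure_mono ?_
    rintro _ ⟨⟨x, hx, rfl⟩, hne⟩
    have h1 := hkmax hx
    refine ⟨by simpa [add_comm] using hC x hx l hl, lt_of_le_of_ne ?_ hne⟩
    simp only [smul_eq_mul, c]
    nlinarith
  · refine measure_mono ?_
    rintro _ ⟨y, hy, rfl⟩
    have h1 := hlmin hy
    refine ⟨hC k hk y hy, ?_⟩
    simp only [smul_eq_mul, c, mem_Iio, not_lt]
    nlinarith

theorem volume_add_le_of_measurableSet_real {a b : ℝ} (ha : 0 < a) (hb : 0 < b) {A B C : Set ℝ}
    (hA : MeasurableSet A) (hB : MeasurableSet B) (hAn : A.Nonempty) (hBn : B.Nonempty)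
    (hC : ∀ x ∈ A, ∀ y ∈ B, a * x + b * y ∈ C) :
    ENNReal.ofReal a * volume A + ENNReal.ofReal b * volume B ≤ volume C := by
  have key : ∀ {S : Set ℝ}, MeasurableSet S → S.Nonempty →
      volume S = ⨆ K : {K : Set ℝ // K ⊆ S ∧ IsCompact K ∧ K.Nonempty}, volume (K : Set ℝ) := by
    intro S hS hSn
    refine le_antisymm (le_of_forall_lt fun r hr => ?_) (iSup_le fun K => measure_mono K.2.1)
    obtain ⟨K, hKS, hKc, hrK⟩ := hS.exists_lt_isCompact hr
    have hKn : K.Nonempty := nonempty_of_measure_ne_zero (ne_bot_of_gt hrK)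
    exact hrK.trans_le (le_iSup (fun K : {K : Set ℝ // K ⊆ S ∧ IsCompact K ∧ K.Nonempty} =>
      volume (K : Set ℝ)) ⟨K, hKS, hKc, hKn⟩)
  have hne : ∀ {S : Set ℝ}, S.Nonempty →
      Nonempty {K : Set ℝ // K ⊆ S ∧ IsCompact K ∧ K.Nonempty} := fun ⟨x, hx⟩ =>
    ⟨⟨{x}, by simpa using hx, isCompact_singleton, singleton_nonempty x⟩⟩
  have := hne hAn
  have := hne hBn
  rw [key hA hAn, key hB hBn, ENNReal.mul_iSup, ENNReal.mul_iSup]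
  refine ENNReal.iSup_add_iSup_le fun K L => ?_
  exact volume_add_le_of_compact_real ha hb K.2.2.1 L.2.2.1 K.2.2.2 L.2.2.2
    fun x hx y hy => hC x (K.2.1 hx) y (L.2.1 hy)

/-- The Prékopa–Leindler inequality with weights `a` and `b` for a measure `μ`. -/
def PrekopaLeindler {E : Type*} [AddCommGroup E] [Module ℝ E] [MeasurableSpace E]
    (μ : Measure E) (a b : ℝ) : Prop :=
  ∀ f g h : E → ℝ≥0∞, Measurable f → Measurable g → Measurable h →
    (∀ x y, f x ^ a * g y ^ b ≤ h (a • x + b • y)) →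
    (∫⁻ x, f x ∂μ) ^ a * (∫⁻ x, g x ∂μ) ^ b ≤ ∫⁻ x, h x ∂μ

theorem lintegral_eq_lintegral_Ioo_meas_lt {f : ℝ → ℝ≥0∞} (hf : Measurable f)
    (hf1 : ∀ x, f x ≤ 1) :
    ∫⁻ x, f x = ∫⁻ t in Ioo (0 : ℝ) 1, volume {x | ENNReal.ofReal t < f x} := by
  have h1 : ∀ x, f x ≠ ∞ := fun x => ne_top_of_le_ne_top ENNReal.one_ne_top (hf1 x)
  have h2 : ∫⁻ x, f x = ∫⁻ x, ENNReal.ofReal (f x).toReal :=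
    lintegral_congr fun x => (ENNReal.ofReal_toReal (h1 x)).symm
  rw [h2, lintegral_eq_lintegral_meas_lt _ (Eventually.of_forall fun x => ENNReal.toReal_nonneg)
    hf.ennreal_toReal.aemeasurable, ← Ioo_union_Ici_eq_Ioi (zero_lt_one' ℝ),
    lintegral_union measurableSet_Ici (by
      rw [Set.disjoint_left]; intro x hx hx'; exact absurd hx.2 (not_lt.2 hx'))]
  have h3 : ∫⁻ t in Ici (1 : ℝ), volume {x | t < (f x).toReal} = 0 := by
    rw [setLIntegral_congr_fun (g := fun _ => 0) measurableSet_Ici]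
    · simp
    · intro t ht
      have : {x | t < (f x).toReal} = ∅ := by
        ext x
        have := ENNReal.toReal_mono ENNReal.one_ne_top (hf1 x)
        simp only [ENNReal.toReal_one] at this
        simpa using this.trans ht
      simp [this]
  rw [h3, add_zero]
  refine setLIntegral_congr_fun measurableSet_Ioo fun t ht => ?_
  simp only [ENNReal.ofReal_lt_iff_lt_toReal ht.1.le (h1 _)]

theorem prekopaLeindler_real_of_iSup_eq_one {a b : ℝ} (ha : 0 < a) (hb : 0 < b) (hab : a + b = 1)
    {f g h : ℝ → ℝ≥0∞} (hf : Measurable f) (hg : Measurable g) (hh : Measurable h)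
    (hfg : ∀ x y, f x ^ a * g y ^ b ≤ h (a * x + b * y))
    (hf1 : ⨆ x, f x = 1) (hg1 : ⨆ x, g x = 1) :
    (∫⁻ x, f x) ^ a * (∫⁻ x, g x) ^ b ≤ ∫⁻ x, h x := by
  have hfle : ∀ x, f x ≤ 1 := fun x => hf1 ▸ le_iSup f x
  have hgle : ∀ x, g x ≤ 1 := fun x => hg1 ▸ le_iSup g x
  calc (∫⁻ x, f x) ^ a * (∫⁻ x, g x) ^ b
      ≤ ENNReal.ofReal a * (∫⁻ x, f x) + ENNReal.ofReal b * ∫⁻ x, g x := by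
        have h1 := ENNReal.young_inequality ((∫⁻ x, f x) ^ a) ((∫⁻ x, g x) ^ b)
          (Real.HolderConjugate.inv_inv ha hb hab)
        rw [ENNReal.rpow_rpow_inv ha.ne', ENNReal.rpow_rpow_inv hb.ne'] at h1
        rwa [ENNReal.ofReal_inv_of_pos ha, ENNReal.ofReal_inv_of_pos hb, div_eq_mul_inv,
          div_eq_mul_inv, inv_inv, inv_inv, mul_comm _ (ENNReal.ofReal a),
          mul_comm _ (ENNReal.ofReal b)] at h1
    _ ≤ ∫⁻ x, min (h x) 1 := by
        rw [lintegral_eq_lintegral_Ioo_meas_lt hf hfle, lintegral_eq_lintegral_Ioo_meas_lt hg hgle,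
          lintegral_eq_lintegral_Ioo_meas_lt (hh.min measurable_const) fun x => min_le_right _ _,
          ← lintegral_const_mul' _ _ ENNReal.ofReal_ne_top,
          ← lintegral_const_mul' _ _ ENNReal.ofReal_ne_top]
        refine (le_lintegral_add _ _).trans ?_
        refine setLIntegral_mono' measurableSet_Ioo fun t ht => ?_
        have ht1 : ENNReal.ofReal t < 1 := by simpa using ht.2
        have hfn : {x | ENNReal.ofReal t < f x}.Nonempty := lt_iSup_iff.1 (ht1.trans_eq hf1.symm)
        have hgn : {x | ENNReal.ofReal t < g x}.Nonempty := lt_iSup_iff.1 (ht1.trans_eq hg1.symm)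
        refine volume_add_le_of_measurableSet_real ha hb (measurableSet_lt measurable_const hf)
          (measurableSet_lt measurable_const hg) hfn hgn fun x hx y hy => ?_
        refine lt_min (lt_of_lt_of_le ?_ (hfg x y)) ht1
        calc ENNReal.ofReal t = ENNReal.ofReal t ^ a * ENNReal.ofReal t ^ b := by
              rw [← ENNReal.rpow_add _ _ (by simpa using ht.1) ENNReal.ofReal_ne_top, hab,
                ENNReal.rpow_one]
          _ < f x ^ a * g y ^ b := ENNReal.mul_lt_mul (ENNReal.rpow_lt_rpow hx ha)
              (ENNReal.rpow_lt_rpow hy hb)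
    _ ≤ ∫⁻ x, h x := lintegral_mono fun x => min_le_left _ _

theorem prekopaLeindler_real_of_iSup_ne_top {a b : ℝ} (ha : 0 < a) (hb : 0 < b) (hab : a + b = 1)
    {f g h : ℝ → ℝ≥0∞} (hf : Measurable f) (hg : Measurable g) (hh : Measurable h)
    (hfg : ∀ x y, f x ^ a * g y ^ b ≤ h (a * x + b * y))
    (hf1 : ⨆ x, f x ≠ ∞) (hg1 : ⨆ x, g x ≠ ∞) :
    (∫⁻ x, f x) ^ a * (∫⁻ x, g x) ^ b ≤ ∫⁻ x, h x := by
  set A := ⨆ x, f x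
  set B := ⨆ x, g x
  rcases eq_or_ne A 0 with hA | hA
  · have : ∀ x, f x = 0 := by simpa [A] using hA
    simp [this, ENNReal.zero_rpow_of_pos ha]
  rcases eq_or_ne B 0 with hB | hB
  · have : ∀ x, g x = 0 := by simpa [B] using hB
    simp [this, ENNReal.zero_rpow_of_pos hb]
  have hA' : A ^ a ≠ 0 := by simp [hA, hf1]
  have hA'' : A ^ a ≠ ∞ := ENNReal.rpow_ne_top_of_nonneg ha.le hf1
  have hB' : B ^ b ≠ 0 := by simp [hB, hg1]
  have hB'' : B ^ b ≠ ∞ := ENNReal.rpow_ne_top_of_nonneg hb.le hg1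
  have key := prekopaLeindler_real_of_iSup_eq_one ha hb hab (f := fun x => A⁻¹ * f x)
    (g := fun x => B⁻¹ * g x) (h := fun x => ((A ^ a)⁻¹ * (B ^ b)⁻¹) * h x)
    (hf.const_mul _) (hg.const_mul _) (hh.const_mul _) (fun x y => by
      rw [ENNReal.mul_rpow_of_nonneg _ _ ha.le, ENNReal.mul_rpow_of_nonneg _ _ hb.le,
        ENNReal.inv_rpow, ENNReal.inv_rpow, mul_mul_mul_comm]
      gcongr
      exact hfg x y)
    (by rw [← ENNReal.mul_iSup, ENNReal.inv_mul_cancel hA hf1])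
    (by rw [← ENNReal.mul_iSup, ENNReal.inv_mul_cancel hB hg1])
  rw [lintegral_const_mul _ hf, lintegral_const_mul _ hg, lintegral_const_mul _ hh,
    ENNReal.mul_rpow_of_nonneg _ _ ha.le, ENNReal.mul_rpow_of_nonneg _ _ hb.le,
        ENNReal.inv_rpow, ENNReal.inv_rpow, mul_mul_mul_comm] at key
  refine (ENNReal.mul_le_mul_iff_right ?_ ?_).1 key
  · exact mul_ne_zero (ENNReal.inv_ne_zero.2 hA'') (ENNReal.inv_ne_zero.2 hB'')
  · exact ENNReal.mul_ne_top (ENNReal.inv_ne_top.2 hA') (ENNReal.inv_ne_top.2 hB')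

theorem prekopaLeindler_real_s3 {a b : ℝ} (ha : 0 < a) (hb : 0 < b) (hab : a + b = 1) :
    PrekopaLeindler (volume : Measure ℝ) a b := by
  intro f g h hf hg hh hfg
  rcases eq_or_ne (∫⁻ x, f x) 0 with hf0 | hf0
  · simp [hf0, ENNReal.zero_rpow_of_pos ha]
  rcases eq_or_ne (∫⁻ x, g x) 0 with hg0 | hg0
  · simp [hg0, ENNReal.zero_rpow_of_pos hb]
  have hlim : ∀ {u : ℝ → ℝ≥0∞}, Measurable u →
      Tendsto (fun M : ℕ => ∫⁻ x, min (u x) M) atTop (nhds (∫⁻ x, u x)) := by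
    intro u hu
    refine lintegral_tendsto_of_tendsto_of_monotone
      (fun M => (hu.min measurable_const).aemeasurable)
      (Eventually.of_forall fun x M N hMN => by simp only; gcongr)
      (Eventually.of_forall fun x => ?_)
    simpa using (tendsto_const_nhds (x := u x)).min ENNReal.tendsto_nat_nhds_top
  have hlim' := ENNReal.Tendsto.mul ((hlim hf).ennrpow_const a) (Or.inl (by simp [hf0, ha.not_gt]))
    ((hlim hg).ennrpow_const b) (Or.inl (by simp [hg0, hb.not_gt]))
  refine le_of_tendsto' hlim' fun M => ?_
  refine prekopaLeindler_real_of_iSup_ne_top ha hb hab (hf.min measurable_const)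
    (hg.min measurable_const) hh (fun x y => le_trans ?_ (hfg x y)) ?_ ?_
  · gcongr <;> exact min_le_left _ _
  · exact ne_top_of_le_ne_top (ENNReal.natCast_ne_top M) (iSup_le fun x => min_le_right _ _)
  · exact ne_top_of_le_ne_top (ENNReal.natCast_ne_top M) (iSup_le fun x => min_le_right _ _)

theorem PrekopaLeindler.prod {E F : Type*} [AddCommGroup E] [Module ℝ E] [MeasurableSpace E]
    [AddCommGroup F] [Module ℝ F] [MeasurableSpace F] {μ : Measure E} {ν : Measure F}
    [SFinite μ] [SFinite ν] {a b : ℝ} (hμ : PrekopaLeindler μ a b) (hν : PrekopaLeindler ν a b) :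
    PrekopaLeindler (μ.prod ν) a b := by
  intro f g h hf hg hh hfg
  rw [lintegral_prod _ hf.aemeasurable, lintegral_prod _ hg.aemeasurable,
    lintegral_prod _ hh.aemeasurable]
  refine hμ _ _ _ hf.lintegral_prod_right' hg.lintegral_prod_right' hh.lintegral_prod_right'
    fun x y => ?_
  exact hν _ _ _ (hf.comp measurable_prodMk_left) (hg.comp measurable_prodMk_left)
    (hh.comp measurable_prodMk_left) fun x' y' => hfg (x, x') (y, y')

theorem prekopaLeindler_pi {a b : ℝ} (ha : 0 < a) (hb : 0 < b) (hab : a + b = 1) (d : ℕ) :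
    PrekopaLeindler (volume : Measure (Fin d → ℝ)) a b := by
  induction d with
  | zero =>
    intro f g h hf hg hh hfg
    have hvol : (volume : Measure (Fin 0 → ℝ)) = Measure.dirac 0 := by
      rw [volume_pi, Measure.pi_of_empty _ 0]
    rw [hvol, lintegral_dirac, lintegral_dirac, lintegral_dirac]
    simpa using hfg 0 0
  | succ d ih =>
    intro f g h hf hg hh hfg
    have hmp := (volume_preserving_piFinSuccAbove (fun _ : Fin (d + 1) => ℝ) 0).symm
    have hm := (MeasurableEquiv.piFinSuccAbove (fun _ : Fin (d + 1) => ℝ) 0).symm.measurable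
    rw [← hmp.lintegral_comp hf, ← hmp.lintegral_comp hg, ← hmp.lintegral_comp hh]
    refine (prekopaLeindler_real_s3 ha hb hab).prod ih _ _ _ (hf.comp hm) (hg.comp hm) (hh.comp hm)
      fun x y => ?_
    refine (hfg _ _).trans_eq (congrArg h ?_)
    ext i
    refine Fin.cases ?_ (fun j => ?_) i <;>
      simp [MeasurableEquiv.piFinSuccAbove_symm_apply, Fin.insertNthEquiv]

theorem volume_rpow_mul_rpow_le {d : ℕ} {a b : ℝ} (ha : 0 < a) (hb : 0 < b) (hab : a + b = 1)
    {A B C : Set (Fin d → ℝ)} (hA : MeasurableSet A) (hB : MeasurableSet B)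
    (hC : MeasurableSet C) (hABC : ∀ x ∈ A, ∀ y ∈ B, a • x + b • y ∈ C) :
    volume A ^ a * volume B ^ b ≤ volume C := by
  have := prekopaLeindler_pi ha hb hab d (A.indicator 1) (B.indicator 1) (C.indicator 1)
    (measurable_one.indicator hA) (measurable_one.indicator hB) (measurable_one.indicator hC)
    (fun x y => by
      by_cases hx : x ∈ A
      · by_cases hy : y ∈ B
        · simp [hx, hy, hABC x hx y hy]
        · simp [hy, ENNReal.zero_rpow_of_pos hb]
      · simp [hx, ENNReal.zero_rpow_of_pos ha])
  simpa [lintegral_indicator_one, hA, hB, hC] using this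

theorem smul_add_pow_le_volumeReal {d : ℕ} {a b : ℝ} (ha : 0 < a) (hb : 0 < b)
    {A B C : Set (Fin d → ℝ)} (hA : MeasurableSet A) (hB : MeasurableSet B)
    (hC : MeasurableSet C) (hC' : volume C ≠ ∞) (hABC : ∀ x ∈ A, ∀ y ∈ B, a • x + b • y ∈ C)
    {α β : ℝ} (hα : 0 < α) (hβ : 0 < β) (hAα : volume A = ENNReal.ofReal (α ^ d))
    (hBβ : volume B = ENNReal.ofReal (β ^ d)) :
    (a * α + b * β) ^ d ≤ volume.real C := by
  set σ := a * α + b * β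
  have hσ : 0 < σ := by positivity
  have hvol : ∀ {r : ℝ} {S : Set (Fin d → ℝ)}, 0 < r →
      volume (r⁻¹ • S) = ENNReal.ofReal (r ^ d)⁻¹ * volume S := by
    intro r S hr
    rw [Measure.addHaar_smul_of_nonneg _ (inv_pos.2 hr).le]
    simp
  have hone : ∀ {r : ℝ}, 0 < r → ENNReal.ofReal (r ^ d)⁻¹ * ENNReal.ofReal (r ^ d) = 1 := by
    intro r hr
    rw [← ENNReal.ofReal_mul (by positivity), inv_mul_cancel₀ (by positivity), ENNReal.ofReal_one]
  have key := volume_rpow_mul_rpow_le (a := a * α / σ) (b := b * β / σ) (by positivity)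
    (by positivity) (by rw [← add_div]; exact div_self hσ.ne')
    (hA.const_smul₀ α⁻¹) (hB.const_smul₀ β⁻¹) (hC.const_smul₀ σ⁻¹) (by
      rintro _ ⟨x, hx, rfl⟩ _ ⟨y, hy, rfl⟩
      refine ⟨_, hABC x hx y hy, ?_⟩
      simp only [smul_add, smul_smul]
      congr 2 <;> field_simp)
  rw [hvol hα, hvol hβ, hvol hσ, hAα, hBβ, hone hα, hone hβ, ENNReal.one_rpow, ENNReal.one_rpow,
    one_mul, ← ENNReal.ofReal_toReal hC', ← ENNReal.ofReal_mul (by positivity),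
    ENNReal.one_le_ofReal, inv_mul_eq_div, one_le_div (by positivity)] at key
  exact key

/-- The Brunn–Minkowski inequality. -/
theorem brunn_minkowski {d : ℕ} (hd : d ≠ 0) {a b : ℝ} (ha : 0 < a) (hb : 0 < b)
    {A B C : Set (Fin d → ℝ)} (hA : MeasurableSet A) (hB : MeasurableSet B)
    (hC : MeasurableSet C) (hAn : A.Nonempty) (hBn : B.Nonempty) (hA' : volume A ≠ ∞)
    (hB' : volume B ≠ ∞) (hC' : volume C ≠ ∞) (hABC : ∀ x ∈ A, ∀ y ∈ B, a • x + b • y ∈ C) :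
    a * volume.real A ^ (d : ℝ)⁻¹ + b * volume.real B ^ (d : ℝ)⁻¹ ≤
      volume.real C ^ (d : ℝ)⁻¹ := by
  have hd' : (0 : ℝ) < d := by positivity
  have hpow : ∀ {S : Set (Fin d → ℝ)}, (volume.real S ^ (d : ℝ)⁻¹) ^ d = volume.real S :=
    fun {S} => Real.rpow_inv_natCast_pow measureReal_nonneg hd
  have hofReal : ∀ {S : Set (Fin d → ℝ)}, volume S ≠ ∞ →
      volume S = ENNReal.ofReal ((volume.real S ^ (d : ℝ)⁻¹) ^ d) := fun {S} hS => by
    rw [hpow, ofReal_measureReal hS]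
  have htranslate : ∀ {r : ℝ} {S : Set (Fin d → ℝ)} (p : Fin d → ℝ), 0 < r →
      (∀ x ∈ S, p + r • x ∈ C) → r * volume.real S ^ (d : ℝ)⁻¹ ≤ volume.real C ^ (d : ℝ)⁻¹ := by
    intro r S p hr h
    have h1 : volume.real ((fun x => p + x) '' (r • S)) ≤ volume.real C := by
      refine measureReal_mono ?_ hC'
      rintro _ ⟨_, ⟨x, hx, rfl⟩, rfl⟩
      exact h x hx
    rw [image_add_left, measureReal_def, measure_preimage_add,
      Measure.addHaar_smul_of_nonneg _ hr.le, ENNReal.toReal_mul,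
      ENNReal.toReal_ofReal (by positivity), ← measureReal_def, Module.finrank_fin_fun] at h1
    have h2 := Real.rpow_le_rpow (by positivity) h1 (inv_pos.2 hd').le
    rw [Real.mul_rpow (by positivity) (by positivity)] at h2
    simpa [Real.pow_rpow_inv_natCast hr.le hd] using h2
  rcases (Real.rpow_nonneg (measureReal_nonneg (μ := volume) (s := A)) (d : ℝ)⁻¹).eq_or_lt'
    with hα | hα
  · obtain ⟨x, hx⟩ := hAn
    rw [hα, mul_zero, zero_add]
    exact htranslate (a • x) hb fun y hy => hABC x hx y hy
  rcases (Real.rpow_nonneg (measureReal_nonneg (μ := volume) (s := B)) (d : ℝ)⁻¹).eq_or_lt'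
    with hβ | hβ
  · obtain ⟨y, hy⟩ := hBn
    rw [hβ, mul_zero, add_zero]
    exact htranslate (b • y) ha fun x hx => by rw [add_comm]; exact hABC x hx y hy
  rw [Real.le_rpow_inv_iff_of_pos (by positivity) measureReal_nonneg hd', Real.rpow_natCast]
  exact smul_add_pow_le_volumeReal ha hb hA hB hC hC' hABC hα hβ (hofReal hA') (hofReal hB')

theorem isCompact_preimage_prodMk {d : ℕ} {Δ : Set (ℝ × (Fin d → ℝ))} (hΔ : IsCompact Δ) (x : ℝ) :
    IsCompact {y : Fin d → ℝ | (x, y) ∈ Δ} :=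
  (hΔ.image continuous_snd).of_isClosed_subset (hΔ.isClosed.preimage (by fun_prop))
    fun y hy => ⟨(x, y), hy, rfl⟩

/-- Brunn's theorem on the slices of a convex body. -/
theorem concaveOn_volumeReal_slice_rpow {d : ℕ} (hd : d ≠ 0) {Δ : Set (ℝ × (Fin d → ℝ))}
    (hΔcomp : IsCompact Δ) (hΔconv : Convex ℝ Δ) :
    ConcaveOn ℝ (Prod.fst '' Δ)
      fun x => volume.real {y : Fin d → ℝ | (x, y) ∈ Δ} ^ (d : ℝ)⁻¹ := by
  refine concaveOn_iff_forall_pos.2 ⟨hΔconv.linear_image (LinearMap.fst ℝ ℝ (Fin d → ℝ)), ?_⟩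
  rintro _ ⟨⟨x, p⟩, hp, rfl⟩ _ ⟨⟨y, q⟩, hq, rfl⟩ a b ha hb hab
  have hcomp := isCompact_preimage_prodMk hΔcomp
  refine brunn_minkowski hd ha hb (hcomp x).measurableSet (hcomp y).measurableSet
    (hcomp _).measurableSet ⟨p, hp⟩ ⟨q, hq⟩ (hcomp x).measure_ne_top (hcomp y).measure_ne_top
    (hcomp _).measure_ne_top fun u hu w hw => ?_
  exact hΔconv hu hw ha.le hb.le hab

theorem volumeReal_slice_pos {d : ℕ} (hd : d ≠ 0) {Δ : Set (ℝ × (Fin d → ℝ))}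
    (hΔcomp : IsCompact Δ) (hΔconv : Convex ℝ Δ) (hΔint : (interior Δ).Nonempty) {t₀ t₁ : ℝ}
    (hproj : Prod.fst '' Δ = Icc t₀ t₁) {e : ℝ} (he : e ∈ Ioo t₀ t₁) :
    0 < volume.real {y : Fin d → ℝ | (e, y) ∈ Δ} := by
  have hconc := concaveOn_volumeReal_slice_rpow hd hΔcomp hΔconv
  rw [hproj] at hconc
  have hcomp := isCompact_preimage_prodMk hΔcomp
  obtain ⟨⟨c, p⟩, hp⟩ := hΔint
  have hc : c ∈ Icc t₀ t₁ := hproj ▸ ⟨(c, p), interior_subset hp, rfl⟩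
  have hcpos : 0 < volume.real {y : Fin d → ℝ | (c, y) ∈ Δ} := by
    have hopen : IsOpen {y : Fin d → ℝ | (c, y) ∈ interior Δ} :=
      isOpen_interior.preimage (by fun_prop)
    have hsub : {y : Fin d → ℝ | (c, y) ∈ interior Δ} ⊆ {y | (c, y) ∈ Δ} :=
      fun _ hy => interior_subset (s := Δ) hy
    exact ENNReal.toReal_pos ((hopen.measure_pos volume ⟨p, hp⟩).trans_le (measure_mono hsub)).ne'
      (hcomp c).measure_ne_top
  have hz : ∃ z ∈ Icc t₀ t₁, ∃ a b : ℝ, 0 < a ∧ 0 ≤ b ∧ a + b = 1 ∧ a • c + b • z = e := by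
    have key : ∀ z, e ∈ segment ℝ c z → e ≠ z →
        ∃ a b : ℝ, 0 < a ∧ 0 ≤ b ∧ a + b = 1 ∧ a • c + b • z = e := by
      rintro z ⟨a, b, ha, hb, hab, h⟩ hne
      refine ⟨a, b, ha.lt_of_ne' fun ha0 => hne ?_, hb, hab, h⟩
      simp_all
    rcases le_total c e with hce | hce
    · exact ⟨t₁, right_mem_Icc.2 (he.1.trans he.2).le,
        key t₁ (by rw [segment_eq_Icc (hce.trans he.2.le)]; exact ⟨hce, he.2.le⟩) he.2.ne⟩
    · exact ⟨t₀, left_mem_Icc.2 (he.1.trans he.2).le,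
        key t₀ (by rw [segment_symm, segment_eq_Icc (he.1.le.trans hce)]; exact ⟨he.1.le, hce⟩)
          he.1.ne'⟩
  obtain ⟨z, hz, a, b, ha, hb, hab, habe⟩ := hz
  have h1 := hconc.2 hc hz ha.le hb hab
  rw [habe] at h1
  refine measureReal_nonneg.lt_of_ne' fun h0 => ?_
  simp only [h0, smul_eq_mul] at h1
  rw [Real.zero_rpow (by simpa using hd)] at h1
  have hc' : 0 < a * volume.real {y : Fin d → ℝ | (c, y) ∈ Δ} ^ (d : ℝ)⁻¹ := by positivity
  have hz' : 0 ≤ b * volume.real {y : Fin d → ℝ | (z, y) ∈ Δ} ^ (d : ℝ)⁻¹ := by positivity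
  linarith

theorem ConcaveOn.le_add_mul_of_hasDerivWithinAt {φ : ℝ → ℝ} {t₀ t₁ e v : ℝ}
    (hφ : ConcaveOn ℝ (Icc t₀ t₁) φ) (he : e ∈ Ioo t₀ t₁)
    (hv : HasDerivWithinAt φ v (Ioi e) e ∨ HasDerivWithinAt φ v (Iio e) e) {x : ℝ}
    (hx : x ∈ Icc e t₁) : φ x ≤ φ e + v * (x - e) := by
  rcases hx.1.eq_or_lt with rfl | hex
  · simp
  have hxI : x ∈ Icc t₀ t₁ := ⟨he.1.le.trans hx.1, hx.2⟩
  have heI : e ∈ Icc t₀ t₁ := Ioo_subset_Icc_self he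
  suffices h : slope φ e x ≤ v by
    rw [slope_def_field, div_le_iff₀ (sub_pos.2 hex)] at h
    linarith
  have hanti := hφ.slope_anti heI
  have hxI' : x ∈ Icc t₀ t₁ \ {e} := ⟨hxI, hex.ne'⟩
  rcases hv with hv | hv
  · rw [hasDerivWithinAt_iff_tendsto_slope' (by simp)] at hv
    refine ge_of_tendsto hv ?_
    filter_upwards [Ioo_mem_nhdsGT hex] with y hy
    exact hanti ⟨⟨heI.1.trans hy.1.le, hy.2.le.trans hx.2⟩, hy.1.ne'⟩ hxI' hy.2.le
  · rw [hasDerivWithinAt_iff_tendsto_slope' (by simp)] at hv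
    refine ge_of_tendsto hv ?_
    filter_upwards [Ioo_mem_nhdsLT he.1] with y hy
    exact hanti ⟨⟨hy.1.le, hy.2.le.trans heI.2⟩, hy.2.ne⟩ hxI' (hy.2.le.trans hx.1)

theorem ConcaveOn.le_mul_pow_of_hasDerivWithinAt {d : ℕ} (hd : d ≠ 0) {g : ℝ → ℝ}
    {t₀ t₁ e v : ℝ} (hg0 : ∀ x, 0 ≤ g x)
    (hg : ConcaveOn ℝ (Icc t₀ t₁) fun x => g x ^ (d : ℝ)⁻¹) (he : e ∈ Ioo t₀ t₁) (hge : 0 < g e)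
    (hv : HasDerivWithinAt g v (Ioi e) e ∨ HasDerivWithinAt g v (Iio e) e) {x : ℝ}
    (hx : x ∈ Icc e t₁) :
    0 ≤ v * (x - e) / (d * g e) + 1 ∧ g x ≤ g e * (v * (x - e) / (d * g e) + 1) ^ d := by
  have hd' : (0 : ℝ) < d := by positivity
  have h1 := hg.le_add_mul_of_hasDerivWithinAt he
    (hv.imp (fun h => h.rpow_const (Or.inl hge.ne')) (fun h => h.rpow_const (Or.inl hge.ne'))) hx
  have h2 : g e ^ (d : ℝ)⁻¹ + v * (d : ℝ)⁻¹ * g e ^ ((d : ℝ)⁻¹ - 1) * (x - e) =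
      g e ^ (d : ℝ)⁻¹ * (v * (x - e) / (d * g e) + 1) := by
    rw [Real.rpow_sub_one hge.ne']
    field_simp
    ring
  rw [h2] at h1
  have hpos : 0 < g e ^ (d : ℝ)⁻¹ := by positivity
  have h3 : 0 ≤ g x ^ (d : ℝ)⁻¹ := Real.rpow_nonneg (hg0 x) _
  refine ⟨nonneg_of_mul_nonneg_right (h3.trans h1) hpos, ?_⟩
  have h4 := pow_le_pow_left₀ h3 h1 d
  rwa [mul_pow, Real.rpow_inv_natCast_pow (hg0 x) hd, Real.rpow_inv_natCast_pow hge.le hd] at h4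

theorem integral_comp_fst_eq_intervalIntegral_mul_volumeReal_slice {d : ℕ}
    {Δ : Set (ℝ × (Fin d → ℝ))} (hΔ : IsCompact Δ) {t₀ t₁ : ℝ} (ht : t₀ ≤ t₁)
    (hproj : Prod.fst '' Δ = Icc t₀ t₁) {F : ℝ → ℝ} (hF : Continuous F) :
    IntervalIntegrable (fun x => F x * volume.real {y : Fin d → ℝ | (x, y) ∈ Δ}) volume t₀ t₁ ∧
      ∫ p in Δ, F p.1 = ∫ x in t₀..t₁, F x * volume.real {y : Fin d → ℝ | (x, y) ∈ Δ} := by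
  have hcomp := isCompact_preimage_prodMk hΔ
  have hint : Integrable (Δ.indicator fun p => F p.1) (volume.prod volume) :=
    (integrable_indicator_iff hΔ.measurableSet).2
      ((hF.comp continuous_fst).continuousOn.integrableOn_compact hΔ)
  have hslice : ∀ x, ∫ y : Fin d → ℝ, Δ.indicator (fun p => F p.1) (x, y) =
      (Icc t₀ t₁).indicator (fun x => F x * volume.real {y : Fin d → ℝ | (x, y) ∈ Δ}) x := by
    intro x
    have h1 : (fun y : Fin d → ℝ => Δ.indicator (fun p => F p.1) (x, y)) =
        {y : Fin d → ℝ | (x, y) ∈ Δ}.indicator fun _ => F x := by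
      ext y; simp [indicator]
    rw [h1, integral_indicator (hcomp x).measurableSet, setIntegral_const, smul_eq_mul, mul_comm]
    by_cases hx : x ∈ Icc t₀ t₁
    · rw [indicator_of_mem hx]
    · have h2 : {y : Fin d → ℝ | (x, y) ∈ Δ} = ∅ := by
        ext y
        exact iff_of_false (fun hy => hx (hproj ▸ ⟨(x, y), hy, rfl⟩)) (by simp)
      rw [indicator_of_notMem hx, h2]
      simp
  constructor
  · have := hint.integral_prod_left
    simp_rw [hslice] at this
    rw [intervalIntegrable_iff_integrableOn_Icc_of_le ht]
    exact (integrable_indicator_iff measurableSet_Icc).1 this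
  · rw [← integral_indicator hΔ.measurableSet, Measure.volume_eq_prod, integral_prod _ hint]
    simp_rw [hslice]
    rw [integral_indicator measurableSet_Icc, intervalIntegral.integral_of_le ht,
      integral_Icc_eq_integral_Ioc]

theorem integral_mul_pow_affine {d : ℕ} (hd : d ≠ 0) {G v e s : ℝ} (hG : 0 < G) (hv : v ≠ 0) :
    ∫ x in e..s, G * (v * (x - e) / (d * G) + 1) ^ d =
      d * G ^ 2 / (v * (d + 1)) * ((v * (s - e) / (d * G) + 1) ^ (d + 1) - 1) := by
  have hd' : (0 : ℝ) < d := by positivity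
  have hd1 : (d : ℝ) + 1 ≠ 0 := by positivity
  rw [intervalIntegral.integral_eq_sub_of_hasDerivAt
    (f := fun x => d * G ^ 2 / (v * (d + 1)) * (v * (x - e) / (d * G) + 1) ^ (d + 1))]
  · simp only [sub_self, mul_zero, zero_div, zero_add, one_pow]
    ring
  · intro x _
    have h := ((((((hasDerivAt_id x).sub_const e).const_mul v).div_const (d * G)).add_const
      1).pow (d + 1)).const_mul (d * G ^ 2 / (v * (d + 1)))
    refine h.congr_deriv ?_
    simp only [id, Nat.add_sub_cancel]
    push_cast
    field_simp
  · exact Continuous.intervalIntegrable (by fun_prop) _ _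

/-- The comparison profile accumulates mass `W` exactly at `s`, without overshooting `t`. -/
theorem endpoint_mem_Icc_and_integral_eq {d : ℕ} (hd : d ≠ 0) {G v e t W s : ℝ} (hG : 0 < G)
    (hL : 0 ≤ v * (t - e) / (d * G) + 1) (hW : 0 ≤ W)
    (hWle : W ≤ ∫ x in e..t, G * (v * (x - e) / (d * G) + 1) ^ d)
    (hsv : v ≠ 0 → s = e + d * G / v *
      ((((d + 1 : ℝ) * v * W + d * G ^ 2) / (d * G ^ 2)) ^ ((1 : ℝ) / (d + 1)) - 1))
    (hs0 : v = 0 → s = e + 1 / G * W) :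
    s ∈ Icc e t ∧ ∫ x in e..s, G * (v * (x - e) / (d * G) + 1) ^ d = W := by
  have hd' : (0 : ℝ) < d := by positivity
  rcases eq_or_ne v 0 with hv | hv
  · have hs := hs0 hv
    simp only [hv, zero_mul, zero_div, zero_add, one_pow, mul_one,
      intervalIntegral.integral_const, smul_eq_mul] at hWle ⊢
    rw [hs]
    refine ⟨⟨by have : 0 ≤ 1 / G * W := by positivity
                linarith, ?_⟩, by field_simp; ring⟩
    have : 1 / G * W ≤ t - e := by rwa [one_div, inv_mul_le_iff₀ hG, mul_comm]
    linarith
  · have hs := hsv hv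
    rw [integral_mul_pow_affine hd hG hv] at hWle ⊢
    set R := ((d + 1 : ℝ) * v * W + d * G ^ 2) / (d * G ^ 2) with hR
    set L := v * (t - e) / (d * G) + 1
    have hRW : W = d * G ^ 2 / (v * (d + 1)) * (R - 1) := by rw [hR]; field_simp; ring
    have hsL : v * (s - e) / (d * G) + 1 = R ^ ((1 : ℝ) / (d + 1)) := by
      rw [hs]; field_simp; ring
    have hst : s - t = d * G / v * (R ^ ((1 : ℝ) / (d + 1)) - L) := by
      rw [hs]; simp only [L]; field_simp; ring
    have hLr : (L ^ (d + 1)) ^ ((1 : ℝ) / (d + 1)) = L := by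
      have := Real.pow_rpow_inv_natCast hL (Nat.succ_ne_zero d)
      rwa [inv_eq_one_div, Nat.cast_succ] at this
    have hexp : (0 : ℝ) ≤ 1 / (d + 1) := by positivity
    have hRpow : 0 ≤ R → (R ^ ((1 : ℝ) / (d + 1))) ^ (d + 1) = R := fun h => by
      have := Real.rpow_inv_natCast_pow h (Nat.succ_ne_zero d)
      rwa [inv_eq_one_div, Nat.cast_succ] at this
    have hLpow : 0 ≤ L ^ (d + 1) := by positivity
    rcases hv.lt_or_gt with hv | hv
    · have hc : d * G ^ 2 / (v * (d + 1)) < 0 :=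
        div_neg_of_pos_of_neg (by positivity) (mul_neg_of_neg_of_pos hv (by positivity))
      have hc' : d * G / v < 0 := div_neg_of_pos_of_neg (by positivity) hv
      have hR1 : R ≤ 1 := by nlinarith
      have hRL : L ^ (d + 1) ≤ R := by nlinarith
      have hR0 : 0 ≤ R := hLpow.trans hRL
      rw [hsL, hRpow hR0]
      have h1 : R ^ ((1 : ℝ) / (d + 1)) ≤ 1 := Real.rpow_le_one hR0 hR1 hexp
      have h2 : L ≤ R ^ ((1 : ℝ) / (d + 1)) := hLr ▸ Real.rpow_le_rpow hLpow hRL hexp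
      exact ⟨⟨by rw [hs]; nlinarith, by nlinarith⟩, hRW.symm⟩
    · have hc : 0 < d * G ^ 2 / (v * (d + 1)) := by positivity
      have hc' : 0 < d * G / v := by positivity
      have hR1 : 1 ≤ R := by nlinarith
      have hRL : R ≤ L ^ (d + 1) := by nlinarith
      have hR0 : 0 ≤ R := zero_le_one.trans hR1
      rw [hsL, hRpow hR0]
      have h1 : 1 ≤ R ^ ((1 : ℝ) / (d + 1)) := Real.one_le_rpow hR1 hexp
      have h2 : R ^ ((1 : ℝ) / (d + 1)) ≤ L := hLr ▸ Real.rpow_le_rpow hR0 hRL hexp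
      exact ⟨⟨by rw [hs]; nlinarith, by nlinarith⟩, hRW.symm⟩

/-- Moving mass to the left does not increase the first moment. -/
theorem integral_id_mul_le_of_integral_eq {g H : ℝ → ℝ} {e s t : ℝ} (hs : s ∈ Icc e t)
    (hg : IntervalIntegrable g volume e t) (hH : Continuous H) (hg0 : ∀ x, 0 ≤ g x)
    (hgH : ∀ x ∈ Icc e s, g x ≤ H x) (hmass : ∫ x in e..s, H x = ∫ x in e..t, g x) :
    ∫ x in e..s, x * H x ≤ ∫ x in e..t, x * g x := by
  have hst : s ∈ uIcc e t := by rwa [uIcc_of_le (hs.1.trans hs.2)]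
  have hg1 : IntervalIntegrable g volume e s := hg.mono_set (uIcc_subset_uIcc_left hst)
  have hg2 : IntervalIntegrable g volume s t := hg.mono_set (uIcc_subset_uIcc_right hst)
  have hH1 : IntervalIntegrable H volume e s := hH.intervalIntegrable _ _
  have hxg1 : IntervalIntegrable (fun x => x * g x) volume e s :=
    hg1.continuousOn_mul continuousOn_id
  have hxg2 : IntervalIntegrable (fun x => x * g x) volume s t :=
    hg2.continuousOn_mul continuousOn_id
  have hxH1 : IntervalIntegrable (fun x => x * H x) volume e s :=
    (continuous_id.mul hH).intervalIntegrable _ _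
  have h1 : ∫ x in e..s, s * (g x - H x) ≤ ∫ x in e..s, (x * g x - x * H x) := by
    refine intervalIntegral.integral_mono_on hs.1 ((hg1.sub hH1).const_mul s) (hxg1.sub hxH1)
      fun x hx => ?_
    nlinarith [hgH x hx, hx.2]
  have h2 : ∫ x in s..t, s * g x ≤ ∫ x in s..t, x * g x := by
    refine intervalIntegral.integral_mono_on hs.2 (hg2.const_mul s) hxg2 fun x hx => ?_
    exact mul_le_mul_of_nonneg_right hx.1 (hg0 x)
  rw [intervalIntegral.integral_const_mul, intervalIntegral.integral_sub hg1 hH1,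
    intervalIntegral.integral_sub hxg1 hxH1] at h1
  rw [intervalIntegral.integral_const_mul] at h2
  rw [← intervalIntegral.integral_add_adjacent_intervals hg1 hg2] at hmass
  rw [← intervalIntegral.integral_add_adjacent_intervals hxg1 hxg2]
  rw [hmass] at h1
  linarith

end BrunnMinkowski

theorem stmt_3
    (n : ℕ) (hn : 2 ≤ n)
    (Δ : Set (ℝ × (Fin (n - 1) → ℝ)))
    (hΔcomp : IsCompact Δ) (hΔconv : Convex ℝ Δ)
    (hΔint : (interior Δ).Nonempty)
    (t₀ t₁ : ℝ) (hproj : Prod.fst '' Δ = Icc t₀ t₁)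
    (V : ℝ) (hV : V = (volume Δ).toReal)
    (b₁ : ℝ) (hb₁ : b₁ = (1 / V) * ∫ p in Δ, p.1)
    (g : ℝ → ℝ)
    (hg : ∀ x : ℝ, g x = (volume {y : Fin (n - 1) → ℝ | (x, y) ∈ Δ}).toReal)
    (e : ℝ) (he : e ∈ Ioo t₀ t₁)
    (v : ℝ)
    (hv : Tendsto (fun x => (g x - g e) / (x - e)) (nhdsWithin e (Ioi e)) (nhds v)
        ∨ Tendsto (fun x => (g x - g e) / (x - e)) (nhdsWithin e (Iio e)) (nhds v))
    (h₀ : ℝ → ℝ)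
    (hh₀ : ∀ x ∈ Icc t₀ e, h₀ x = g x)
    (hh₀' : ∀ x ∈ Icc e t₁,
      h₀ x = g e * (v * (x - e) / (((n : ℝ) - 1) * g e) + 1) ^ (n - 1))
    (s₀ : ℝ)
    (hs₀v : v ≠ 0 → s₀ = e + (((n : ℝ) - 1) * g e / v) *
      ((((n : ℝ) * v * (V - ∫ x in t₀..e, g x) + ((n : ℝ) - 1) * g e ^ 2) /
          (((n : ℝ) - 1) * g e ^ 2)) ^ ((1 : ℝ) / (n : ℝ)) - 1))
    (hs₀0 : v = 0 → s₀ = e + (1 / g e) * (V - ∫ x in t₀..e, g x)) :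
    b₁ ≥ (1 / V) * ∫ x in t₀..s₀, x * h₀ x := by
  obtain ⟨d, rfl⟩ : ∃ d, n = d + 1 := ⟨n - 1, by omega⟩
  have hd : d ≠ 0 := by omega
  have hcast : ((d + 1 : ℕ) : ℝ) - 1 = d := by push_cast; ring
  have hcast' : ((d + 1 : ℕ) : ℝ) = (d : ℝ) + 1 := by push_cast; ring
  simp only [hcast] at hs₀v hh₀'
  rw [hcast'] at hs₀v
  change Set (ℝ × (Fin d → ℝ)) at Δ
  change (Prod.fst : ℝ × (Fin d → ℝ) → ℝ) '' Δ = Icc t₀ t₁ at hproj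
  change b₁ = 1 / V * ∫ p : ℝ × (Fin d → ℝ) in Δ, p.1 at hb₁
  change ∀ x ∈ Icc e t₁, h₀ x = g e * (v * (x - e) / (d * g e) + 1) ^ d at hh₀'
  obtain rfl : g = fun x => volume.real {y : Fin d → ℝ | (x, y) ∈ Δ} := funext hg
  have ht : t₀ ≤ t₁ := he.1.le.trans he.2.le
  have heI : e ∈ uIcc t₀ t₁ := by rw [uIcc_of_le ht]; exact Ioo_subset_Icc_self he
  have hg0 : ∀ x, 0 ≤ volume.real {y : Fin d → ℝ | (x, y) ∈ Δ} := fun x => measureReal_nonneg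
  have hge := volumeReal_slice_pos hd hΔcomp hΔconv hΔint hproj he
  have hconc := concaveOn_volumeReal_slice_rpow hd hΔcomp hΔconv
  rw [hproj] at hconc
  obtain ⟨hint, hV'⟩ := integral_comp_fst_eq_intervalIntegral_mul_volumeReal_slice hΔcomp ht hproj
    (F := fun _ => 1) continuous_const
  obtain ⟨hxint, hb'⟩ := integral_comp_fst_eq_intervalIntegral_mul_volumeReal_slice hΔcomp ht hproj
    (F := fun x => x) continuous_id
  simp only [one_mul, setIntegral_const, smul_eq_mul, mul_one] at hint hV'
  replace hV' := hV.trans hV'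
  set g : ℝ → ℝ := fun x => volume.real {y : Fin d → ℝ | (x, y) ∈ Δ}
  have hbound := fun x (hx : x ∈ Icc e t₁) => hconc.le_mul_pow_of_hasDerivWithinAt hd hg0 he hge
    (hv.imp (fun h => (hasDerivWithinAt_iff_tendsto_slope' (by simp)).2
        (by simpa only [slope_fun_def_field] using h))
      (fun h => (hasDerivWithinAt_iff_tendsto_slope' (by simp)).2
        (by simpa only [slope_fun_def_field] using h))) hx
  have hint1 : IntervalIntegrable g volume t₀ e := hint.mono_set (uIcc_subset_uIcc_left heI)
  have hint2 : IntervalIntegrable g volume e t₁ := hint.mono_set (uIcc_subset_uIcc_right heI)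
  have hxint1 := hxint.mono_set (uIcc_subset_uIcc_left heI)
  have hxint2 := hxint.mono_set (uIcc_subset_uIcc_right heI)
  have hW : V - ∫ x in t₀..e, g x = ∫ x in e..t₁, g x := by
    rw [hV', ← intervalIntegral.integral_add_adjacent_intervals hint1 hint2, add_sub_cancel_left]
  rw [hW] at hs₀v hs₀0
  have hHcont : Continuous fun x => g e * (v * (x - e) / (d * g e) + 1) ^ d := by fun_prop
  obtain ⟨hs, hmass⟩ := endpoint_mem_Icc_and_integral_eq hd hge
    (hbound t₁ (right_mem_Icc.2 he.2.le)).1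
    (intervalIntegral.integral_nonneg he.2.le fun x _ => hg0 x)
    (intervalIntegral.integral_mono_on he.2.le hint2 (hHcont.intervalIntegrable _ _)
      fun x hx => (hbound x hx).2) hs₀v hs₀0
  have hmoment := integral_id_mul_le_of_integral_eq hs hint2 hHcont hg0
    (fun x hx => (hbound x ⟨hx.1, hx.2.trans hs.2⟩).2) hmass
  have hleft : EqOn (fun x => x * g x) (fun x => x * h₀ x) (uIcc t₀ e) := fun x hx => by
    rw [uIcc_of_le he.1.le] at hx
    simp only [hh₀ x hx]
  have hright : EqOn (fun x => x * (g e * (v * (x - e) / (d * g e) + 1) ^ d))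
      (fun x => x * h₀ x) (uIcc e s₀) := fun x hx => by
    rw [uIcc_of_le hs.1] at hx
    simp only [hh₀' x ⟨hx.1, hx.2.trans hs.2⟩]
  have hV0 : 0 ≤ V := hV ▸ ENNReal.toReal_nonneg
  rw [hb₁, ge_iff_le]
  refine mul_le_mul_of_nonneg_left ?_ (one_div_nonneg.2 hV0)
  rw [hb', ← intervalIntegral.integral_add_adjacent_intervals hxint1 hxint2,
    ← intervalIntegral.integral_add_adjacent_intervals
      (hxint1.congr (hleft.mono uIoc_subset_uIcc))
      (IntervalIntegrable.congr (hright.mono uIoc_subset_uIcc)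
        ((continuous_id.mul hHcont).intervalIntegrable e s₀)),
    ← intervalIntegral.integral_congr hleft, ← intervalIntegral.integral_congr hright]
  exact add_le_add le_rfl hmoment
end

section
/- Under the stated setup, for y ∈ [e, t] define W(y) := ∫_{t₀}^{y} h₀(x) dx + ∫_{y}^{t} h₀(y)·((t−x)/(t−y))^{n−1} dx (with W(t) := ∫_{t₀}^{t} h₀(x) dx). Then W(e) ≤ V ≤ W(t), W is non-decreasing on [e, t], and the explicit value s₁ — defined as s₁ = e + ((n−1)g(e)/v)·( ( (n·v·(V − ∫_{t₀}^{e} g(x)dx) + (n−1)g(e)²) / (g(e)·(v(t−e) + (n−1)g(e))) )^{1/(n−1)} − 1 ) if v ≠ 0, and s₁ = ( n(V − ∫_{t₀}^{e} g(x)dx) − g(e)(t − n·e) ) / ((n−1)g(e)) if v = 0 — lies in [e, t] and satisfies W(s₁) = V. -/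
open MeasureTheory Set Filter

theorem IsCompact.volume_slice_ne_top {m : ℕ} {Δ : Set (ℝ × (Fin m → ℝ))}
    (hcomp : IsCompact Δ) (x : ℝ) : volume {y | (x, y) ∈ Δ} ≠ ⊤ := by
  refine ((measure_mono ?_).trans_lt (hcomp.image continuous_snd).measure_lt_top).ne
  exact fun y hy => ⟨(x, y), hy, rfl⟩

/-- Slices of a convex set along a segment towards one of its points shrink at most like the
slices of a cone. -/
theorem Convex.pow_mul_volume_slice_le {m : ℕ} {Δ : Set (ℝ × (Fin m → ℝ))}
    (hconv : Convex ℝ Δ) (hcomp : IsCompact Δ) {a c r : ℝ} {q : Fin m → ℝ} (hq : (c, q) ∈ Δ)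
    (hr₀ : 0 ≤ r) (hr₁ : r ≤ 1) :
    r ^ m * (volume {y | (a, y) ∈ Δ}).toReal
      ≤ (volume {y | (r * a + (1 - r) * c, y) ∈ Δ}).toReal := by
  have hsub : AffineMap.homothety q r '' {y | (a, y) ∈ Δ}
      ⊆ {y | (r * a + (1 - r) * c, y) ∈ Δ} := by
    rintro _ ⟨y, hy, rfl⟩
    have h := hconv hy hq hr₀ (sub_nonneg.2 hr₁) (by ring)
    simp only [mem_ofPred_eq]
    convert h using 1
    ext i
    · simp
    · simp [AffineMap.homothety_apply]
      ring
  have h := ENNReal.toReal_mono (hcomp.volume_slice_ne_top _) (measure_mono hsub)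
  rwa [Measure.addHaar_image_homothety, ENNReal.toReal_mul, Module.finrank_fin_fun,
    abs_of_nonneg (by positivity), ENNReal.toReal_ofReal (by positivity)] at h

theorem Convex.volume_slice_pos {m : ℕ} {Δ : Set (ℝ × (Fin m → ℝ))}
    (hconv : Convex ℝ Δ) (hcomp : IsCompact Δ) (hint : (interior Δ).Nonempty)
    {t₀ t₁ e : ℝ} (hproj : Prod.fst '' Δ = Icc t₀ t₁) (he : e ∈ Ioo t₀ t₁) :
    0 < (volume {y | (e, y) ∈ Δ}).toReal := by
  obtain ⟨⟨x, y⟩, hxy⟩ := hint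
  have key : ∀ c ∈ Icc t₀ t₁, ∀ r : ℝ, 0 < r → r ≤ 1 → r * x + (1 - r) * c = e →
      ∃ z, (e, z) ∈ interior Δ := by
    intro c hc r hr₀ hr₁ hr
    obtain ⟨⟨c', q⟩, hq, rfl⟩ := hproj ▸ hc
    have h := hconv.combo_interior_self_mem_interior hxy hq hr₀ (sub_nonneg.2 hr₁) (by ring)
    exact ⟨r • y + (1 - r) • q, by simpa [hr] using h⟩
  obtain ⟨z, hz⟩ : ∃ z, (e, z) ∈ interior Δ := by
    have h01 : t₀ ≤ t₁ := (he.1.trans he.2).le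
    rcases le_total e x with hex | hex
    · have hx : 0 < x - t₀ := by linarith [he.1]
      refine key t₀ (left_mem_Icc.2 h01) ((e - t₀) / (x - t₀)) (div_pos (by linarith [he.1]) hx)
        ((div_le_one hx).2 (by linarith)) ?_
      field_simp
      ring
    · have hx : 0 < t₁ - x := by linarith [he.2]
      refine key t₁ (right_mem_Icc.2 h01) ((t₁ - e) / (t₁ - x)) (div_pos (by linarith [he.2]) hx)
        ((div_le_one hx).2 (by linarith)) ?_
      field_simp
      ring
  refine ENNReal.toReal_pos (ne_of_gt ?_) (hcomp.volume_slice_ne_top e)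
  have hopen : IsOpen {y | (e, y) ∈ interior Δ} :=
    isOpen_interior.preimage (Continuous.prodMk_right e)
  exact (hopen.measure_pos volume ⟨z, hz⟩).trans_le
    (measure_mono fun _ hy => interior_subset (s := Δ) hy)

theorem IsCompact.integrable_volume_slice {m : ℕ} {Δ : Set (ℝ × (Fin m → ℝ))}
    (hcomp : IsCompact Δ) : Integrable fun x => (volume {y | (x, y) ∈ Δ}).toReal :=
  Measure.integrable_measure_prodMk_left hcomp.measurableSet hcomp.measure_lt_top.ne

theorem IsCompact.volume_eq_integral_slice {m : ℕ} {Δ : Set (ℝ × (Fin m → ℝ))}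
    (hcomp : IsCompact Δ) :
    (volume Δ).toReal = ∫ x, (volume {y | (x, y) ∈ Δ}).toReal := by
  have h := integral_toReal (μ := volume)
    (measurable_measure_prodMk_left (ν := (volume : Measure (Fin m → ℝ)))
      hcomp.measurableSet).aemeasurable
    (ae_of_all _ fun x => (hcomp.volume_slice_ne_top x).lt_top)
  rw [← Measure.prod_apply hcomp.measurableSet] at h
  exact h.symm

theorem integral_cone_section (m : ℕ) (c : ℝ) {y t : ℝ} (hyt : y ≤ t) :
    ∫ x in y..t, c * ((t - x) / (t - y)) ^ m = c * (t - y) / (m + 1) := by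
  rcases hyt.eq_or_lt with rfl | hlt
  · simp
  have h : t - y ≠ 0 := (sub_pos.2 hlt).ne'
  have hm : (m : ℝ) + 1 ≠ 0 := by positivity
  rw [intervalIntegral.integral_const_mul]
  simp_rw [div_pow]
  rw [intervalIntegral.integral_div, intervalIntegral.integral_comp_sub_left (fun x => x ^ m) t,
    integral_pow]
  simp only [sub_self, ne_eq, Nat.add_eq_zero_iff, one_ne_zero, and_false, not_false_eq_true,
    zero_pow, sub_zero]
  field_simp
  ring

theorem integral_affine_pow (m : ℕ) {k : ℝ} (hk : k ≠ 0) (e y : ℝ) :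
    ∫ x in e..y, (k * (x - e) + 1) ^ m = ((k * (y - e) + 1) ^ (m + 1) - 1) / ((m + 1) * k) := by
  have h := intervalIntegral.integral_comp_mul_add (a := e) (b := y) (fun x : ℝ => x ^ m) hk
    (1 - k * e)
  have h' : ∀ x, k * x + (1 - k * e) = k * (x - e) + 1 := fun x => by ring
  simp only [h'] at h
  rw [h, integral_pow]
  have hm : (m : ℝ) + 1 ≠ 0 := by positivity
  simp
  field_simp

/-- A lower bound for a one-sided derivative of a function that dominates the cone profile with
apex over `t` to the right of `e` and is dominated by it to the left of `e`. -/
theorem neg_mul_le_of_tendsto_slope {g : ℝ → ℝ} {m : ℕ} {e t v : ℝ} (het : e < t)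
    (hr : ∀ x ∈ Ioo e t, g e * ((t - x) / (t - e)) ^ m ≤ g x)
    (hl : ∀ x < e, g x ≤ g e * ((t - x) / (t - e)) ^ m)
    (hv : Tendsto (fun x => (g x - g e) / (x - e)) (nhdsWithin e (Ioi e)) (nhds v)
        ∨ Tendsto (fun x => (g x - g e) / (x - e)) (nhdsWithin e (Iio e)) (nhds v)) :
    0 ≤ v * (t - e) + m * g e := by
  have hte : 0 < t - e := sub_pos.2 het
  set φ : ℝ → ℝ := fun x => g e * ((t - x) / (t - e)) ^ m with hφ
  have hφe : φ e = g e := by simp [hφ, div_self hte.ne']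
  have hd : HasDerivAt φ (-(m * g e / (t - e))) e := by
    have h := ((((hasDerivAt_id e).const_sub t).div_const (t - e)).pow m).const_mul (g e)
    refine h.congr_deriv ?_
    simp [div_self hte.ne']
    ring
  have hslope := hasDerivAt_iff_tendsto_slope.1 hd
  have hfun : slope φ e = fun x => (φ x - g e) / (x - e) := by
    funext x
    rw [slope_def_field, hφe]
  rw [hfun] at hslope
  have key : -(m * g e / (t - e)) ≤ v := by
    rcases hv with hv | hv
    · refine le_of_tendsto_of_tendsto
        (hslope.mono_left (nhdsGT_le_nhdsNE e)) hv ?_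
      filter_upwards [Ioo_mem_nhdsGT het] with x hx
      have := sub_pos.2 hx.1
      have := hr x hx
      gcongr
    · refine le_of_tendsto_of_tendsto
        (hslope.mono_left (nhdsLT_le_nhdsNE e)) hv ?_
      filter_upwards [self_mem_nhdsWithin] with x hx
      exact div_le_div_of_nonpos_of_le (sub_neg.2 hx).le (sub_le_sub_right (hl x hx) _)
  rw [neg_le_iff_add_nonneg] at key
  have := mul_nonneg key hte.le
  rwa [add_mul, div_mul_cancel₀ _ hte.ne'] at this

theorem stmt_4
    (n : ℕ) (hn : 2 ≤ n)
    (Δ : Set (ℝ × (Fin (n - 1) → ℝ)))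
    (hΔcomp : IsCompact Δ) (hΔconv : Convex ℝ Δ)
    (hΔint : (interior Δ).Nonempty)
    (t₀ t₁ : ℝ) (hproj : Prod.fst '' Δ = Icc t₀ t₁)
    (V : ℝ) (hV : V = (volume Δ).toReal)
    (b₁ : ℝ) (hb₁ : b₁ = (1 / V) * ∫ p in Δ, p.1)
    (g : ℝ → ℝ)
    (hg : ∀ x : ℝ, g x = (volume {y : Fin (n - 1) → ℝ | (x, y) ∈ Δ}).toReal)
    (e : ℝ) (he : e ∈ Ioo t₀ t₁)
    (v : ℝ)
    (hv : Tendsto (fun x => (g x - g e) / (x - e)) (nhdsWithin e (Ioi e)) (nhds v)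
        ∨ Tendsto (fun x => (g x - g e) / (x - e)) (nhdsWithin e (Iio e)) (nhds v))
    (h₀ : ℝ → ℝ)
    (hh₀ : ∀ x ∈ Icc t₀ e, h₀ x = g x)
    (hh₀' : ∀ x ∈ Icc e t₁,
      h₀ x = g e * (v * (x - e) / (((n : ℝ) - 1) * g e) + 1) ^ (n - 1))
    (t : ℝ) (ht : t ∈ Ioc e t₁)
    (htV : V ≤ ∫ x in t₀..t, h₀ x)
    (W : ℝ → ℝ)
    (hW : ∀ y ∈ Icc e t,
      W y = (∫ x in t₀..y, h₀ x) + ∫ x in y..t, h₀ y * ((t - x) / (t - y)) ^ (n - 1))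
    (s₁ : ℝ)
    (hs₁v : v ≠ 0 → s₁ = e + (((n : ℝ) - 1) * g e / v) *
      ((((n : ℝ) * v * (V - ∫ x in t₀..e, g x) + ((n : ℝ) - 1) * g e ^ 2) /
          (g e * (v * (t - e) + ((n : ℝ) - 1) * g e))) ^ ((1 : ℝ) / ((n : ℝ) - 1)) - 1))
    (hs₁0 : v = 0 → s₁ = ((n : ℝ) * (V - ∫ x in t₀..e, g x) - g e * (t - (n : ℝ) * e)) /
      (((n : ℝ) - 1) * g e)) :
    W e ≤ V ∧ V ≤ W t ∧ MonotoneOn W (Icc e t) ∧ s₁ ∈ Icc e t ∧ W s₁ = V := by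
  obtain ⟨m, rfl⟩ : ∃ m, n = m + 1 := ⟨n - 1, by omega⟩
  have hm : m ≠ 0 := by omega
  have hcast : ((m + 1 : ℕ) : ℝ) = m + 1 := by push_cast; ring
  simp only [hcast, add_sub_cancel_right, Nat.add_sub_cancel] at hh₀' hW hs₁v hs₁0
  have hm₀ : (0 : ℝ) < m := by exact_mod_cast Nat.pos_of_ne_zero hm
  have hgfun : g = fun x => (volume {y : Fin m → ℝ | (x, y) ∈ Δ}).toReal := funext hg
  have hge : 0 < g e := hg e ▸ hΔconv.volume_slice_pos hΔcomp hΔint hproj he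
  have hgint : Integrable g := hgfun ▸ hΔcomp.integrable_volume_slice
  have hg₀ : ∀ x, 0 ≤ g x := fun x => hg x ▸ ENNReal.toReal_nonneg
  have het : e < t := ht.1
  have hte : 0 < t - e := sub_pos.2 het
  obtain ⟨q, hq⟩ : ∃ q, (t, q) ∈ Δ := by
    obtain ⟨⟨_, q⟩, hq, rfl⟩ : t ∈ Prod.fst '' Δ := hproj ▸ ⟨he.1.le.trans het.le, ht.2⟩
    exact ⟨q, hq⟩
  have hcone : ∀ a r : ℝ, 0 ≤ r → r ≤ 1 → r ^ m * g a ≤ g (r * a + (1 - r) * t) := by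
    intro a r h₀ h₁
    rw [hg, hg]
    exact hΔconv.pow_mul_volume_slice_le hΔcomp hq h₀ h₁
  have hr : ∀ x ∈ Icc e t, g e * ((t - x) / (t - e)) ^ m ≤ g x := by
    intro x hx
    have h := hcone e ((t - x) / (t - e)) (div_nonneg (sub_nonneg.2 hx.2) hte.le)
      ((div_le_one hte).2 (by linarith [hx.1]))
    rwa [mul_comm, show (t - x) / (t - e) * e + (1 - (t - x) / (t - e)) * t = x by
      field_simp; ring] at h
  have hl : ∀ x < e, g x ≤ g e * ((t - x) / (t - e)) ^ m := by
    intro x hx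
    have htx : 0 < t - x := by linarith
    have h := hcone x ((t - e) / (t - x)) (div_nonneg hte.le htx.le)
      ((div_le_one htx).2 (by linarith))
    rw [show (t - e) / (t - x) * x + (1 - (t - e) / (t - x)) * t = e by
      field_simp; ring] at h
    calc g x = ((t - e) / (t - x)) ^ m * g x * ((t - x) / (t - e)) ^ m := by
          rw [mul_right_comm, ← mul_pow, div_mul_div_comm, mul_comm (t - x), div_self (by positivity),
            one_pow, one_mul]
      _ ≤ _ := by gcongr
  have hM := neg_mul_le_of_tendsto_slope het (fun x hx => hr x (Ioo_subset_Icc_self hx)) hl hv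
  set A := ∫ x in t₀..e, g x with hA
  have hh₀int : ∫ x in t₀..e, h₀ x = A := by
    refine intervalIntegral.integral_congr fun x hx => hh₀ x ?_
    rwa [uIcc_of_le he.1.le] at hx
  set L : ℝ → ℝ := fun x => v / (m * g e) * (x - e) + 1 with hL
  have hh₀L : ∀ x ∈ Icc e t, h₀ x = g e * L x ^ m := by
    intro x hx
    rw [hh₀' x ⟨hx.1, hx.2.trans ht.2⟩]
    simp only [hL]
    ring
  have hWL : ∀ y ∈ Icc e t,
      W y = A + g e * (∫ x in e..y, L x ^ m) + g e * L y ^ m * (t - y) / (m + 1) := by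
    intro y hy
    have hy' : ∀ x ∈ uIcc e y, h₀ x = g e * L x ^ m := fun x hx => by
      rw [uIcc_of_le hy.1] at hx
      exact hh₀L x ⟨hx.1, hx.2.trans hy.2⟩
    have hcont : Continuous fun x => g e * L x ^ m := by fun_prop
    rw [hW y hy, integral_cone_section m _ hy.2, hh₀L y hy,
      ← intervalIntegral.integral_add_adjacent_intervals (a := t₀) (b := e) (c := y), hh₀int,
      intervalIntegral.integral_congr hy', intervalIntegral.integral_const_mul]
    · refine hgint.intervalIntegrable.congr fun x hx => (hh₀ x ?_).symm
      rw [uIoc_of_le he.1.le] at hx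
      exact Ioc_subset_Icc_self hx
    · exact (hcont.intervalIntegrable e y).congr fun x hx => (hy' x (uIoc_subset_uIcc hx)).symm
  have heI : e ∈ Icc e t := left_mem_Icc.2 het.le
  have htI : t ∈ Icc e t := right_mem_Icc.2 het.le
  have hWe : W e ≤ V := by
    have hV' : A + ∫ x in e..t, g x ≤ V := by
      rw [hA, intervalIntegral.integral_add_adjacent_intervals hgint.intervalIntegrable
        hgint.intervalIntegrable, intervalIntegral.integral_of_le (he.1.le.trans het.le), hV,
        hΔcomp.volume_eq_integral_slice]
      simp only [← hg]
      exact setIntegral_le_integral hgint (ae_of_all _ hg₀)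
    rw [hW e heI, hh₀int, hh₀ e ⟨he.1.le, le_rfl⟩]
    refine le_trans (add_le_add_right ?_ A) hV'
    refine intervalIntegral.integral_mono_on het.le (Continuous.intervalIntegrable (by fun_prop) _ _)
      hgint.intervalIntegrable hr
  have hWt : V ≤ W t := by
    simpa [hW t htI] using htV
  have hWcont : ContinuousOn W (Icc e t) := by
    refine ContinuousOn.congr (Continuous.continuousOn ?_) hWL
    have hc : Continuous fun y => ∫ x in e..y, L x ^ m :=
      intervalIntegral.continuous_primitive
        (fun a b => Continuous.intervalIntegrable (by fun_prop) a b) e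
    fun_prop
  obtain ⟨s, hs, hWs⟩ := intermediate_value_Icc het.le hWcont ⟨hWe, hWt⟩
  refine ⟨hWe, hWt, ?_⟩
  rcases eq_or_ne v 0 with rfl | hv₀
  · have hW0 : ∀ y ∈ Icc e t, W y = A + g e * (y - e) + g e * (t - y) / (m + 1) := by
      intro y hy
      simp [hWL y hy, hL]
    refine ⟨fun x hx y hy hxy => ?_, ?_⟩
    · have h : W y - W x = g e * m / (m + 1) * (y - x) := by
        rw [hW0 x hx, hW0 y hy]
        field_simp
        ring
      have : 0 ≤ g e * m / (m + 1) * (y - x) := mul_nonneg (by positivity) (sub_nonneg.2 hxy)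
      linarith
    · suffices s₁ = s from this ▸ ⟨hs, hWs⟩
      rw [hs₁0 rfl, ← hWs, hW0 s hs]
      field_simp
      ring
  · have hWv : ∀ y ∈ Icc e t, (m + 1) * v * (W y - A) + m * g e ^ 2
        = g e * (v * (t - e) + m * g e) * L y ^ m := by
      intro y hy
      rw [hWL y hy, integral_affine_pow m (div_ne_zero hv₀ (by positivity)),
        show v / (m * g e) * (y - e) + 1 = L y from rfl]
      have hLy : v * (y - e) = (L y - 1) * (m * g e) := by
        simp only [hL]
        field_simp
        ring
      have hty : v * (t - y) = v * (t - e) - (L y - 1) * (m * g e) := by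
        rw [← hLy]; ring
      generalize L y = l at *
      have : (m + 1) * v * (A + g e * ((l ^ (m + 1) - 1) / ((m + 1) * (v / (m * g e))))
            + g e * l ^ m * (t - y) / (m + 1) - A)
          = m * g e ^ 2 * (l ^ (m + 1) - 1) + g e * l ^ m * (v * (t - y)) := by
        field_simp
        ring
      rw [this, hty]
      ring
    have hL₀ : ∀ y ∈ Icc e t, 0 ≤ L y := by
      intro y hy
      have h : L y = ((t - y) * (m * g e) + (y - e) * (v * (t - e) + m * g e))
          / ((t - e) * (m * g e)) := by
        simp only [hL]
        field_simp
        ring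
      rw [h]
      have h₁ := sub_nonneg.2 hy.1
      have h₂ := sub_nonneg.2 hy.2
      positivity
    refine ⟨fun x hx y hy hxy => ?_, ?_⟩
    · have h : (m + 1) * v * (W y - W x)
          = g e * (v * (t - e) + m * g e) * (L y ^ m - L x ^ m) := by
        linear_combination hWv y hy - hWv x hx
      have hM' : 0 ≤ g e * (v * (t - e) + m * g e) := by positivity
      have hm₁ : (0 : ℝ) < m + 1 := by positivity
      rcases hv₀.lt_or_gt with hneg | hpos
      · have hLL : L y ≤ L x := by
          have : v / (m * g e) ≤ 0 := div_nonpos_of_nonpos_of_nonneg hneg.le (by positivity)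
          simp only [hL]
          nlinarith
        have := mul_nonpos_of_nonneg_of_nonpos hM'
          (sub_nonpos.2 (pow_le_pow_left₀ (hL₀ y hy) hLL m))
        rw [← h] at this
        have := nonneg_of_mul_nonpos_right this (mul_neg_of_pos_of_neg hm₁ hneg)
        linarith
      · have hLL : L x ≤ L y := by
          have : 0 ≤ v / (m * g e) := by positivity
          simp only [hL]
          nlinarith
        have := mul_nonneg hM' (sub_nonneg.2 (pow_le_pow_left₀ (hL₀ x hx) hLL m))
        rw [← h] at this
        have := nonneg_of_mul_nonneg_right this (mul_pos hm₁ hpos)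
        linarith
    · rcases hM.eq_or_lt with hM₀ | hMpos
      · have hs₁t : s₁ = t := by
          rw [hs₁v hv₀, ← hM₀, mul_zero, div_zero, Real.zero_rpow (by positivity)]
          field_simp
          linear_combination hM₀
        have hWV : (m + 1) * v * (W t - V) = 0 := by
          have h₁ := hWv t htI
          have h₂ := hWv s hs
          rw [← hM₀] at h₁ h₂
          rw [← hWs]
          linear_combination h₁ - h₂
        have hm₁ : (m : ℝ) + 1 ≠ 0 := by positivity
        rw [hs₁t]
        exact ⟨htI, sub_eq_zero.1 ((mul_eq_zero.1 hWV).resolve_left (mul_ne_zero hm₁ hv₀))⟩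
      · suffices s₁ = s from this ▸ ⟨hs, hWs⟩
        rw [hs₁v hv₀, ← hWs, hWv s hs, mul_div_cancel_left₀ _ (by positivity), one_div,
          Real.pow_rpow_inv_natCast (hL₀ s hs) hm]
        simp only [hL]
        field_simp
        ring
end

section
/- Under the stated setup, for every x ∈ [e, t₁] one has g(x) ≥ g(e)·((t₁−x)/(t₁−e))^{n−1}; consequently ∫_{t₀}^{e} g(x) dx + (t₁−e)·g(e)/n ≤ V. -/
open MeasureTheory Set Filter

/-- A convex set contains the cone over the slice at `e` with any apex `(t, z)` of the set, so the
slices between `e` and `t` are at least as large as those of the cone. -/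
theorem Convex.volume_slice_ge_homothety {m : ℕ} {Δ : Set (ℝ × (Fin m → ℝ))}
    (hconv : Convex ℝ Δ) {t e x : ℝ} {z : Fin m → ℝ} (hz : (t, z) ∈ Δ) (het : e < t)
    (hx : x ∈ Icc e t) :
    ENNReal.ofReal (((t - x) / (t - e)) ^ m) * volume {y : Fin m → ℝ | (e, y) ∈ Δ}
      ≤ volume {y : Fin m → ℝ | (x, y) ∈ Δ} := by
  have hpos : 0 < t - e := sub_pos.2 het
  set r := (t - x) / (t - e) with hr
  have hr0 : 0 ≤ r := div_nonneg (sub_nonneg.2 hx.2) hpos.le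
  have hr1 : r ≤ 1 := (div_le_one hpos).2 (by linarith [hx.1])
  have hvol := Measure.addHaar_image_homothety (volume : Measure (Fin m → ℝ)) z r
    {y : Fin m → ℝ | (e, y) ∈ Δ}
  rw [Module.finrank_fin_fun, abs_of_nonneg (pow_nonneg hr0 m)] at hvol
  rw [← hvol]
  refine measure_mono ?_
  rintro _ ⟨y, hy, rfl⟩
  have h := hconv hy hz hr0 (sub_nonneg.2 hr1) (by ring)
  have hfst : r * e + (1 - r) * t = x := by
    have : r * (t - e) = t - x := div_mul_cancel₀ _ hpos.ne'
    linarith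
  have heq : r • (e, y) + (1 - r) • (t, z) = (x, AffineMap.homothety z r y) := by
    ext i
    · simpa using hfst
    · simp [AffineMap.homothety_apply]
      ring
  rw [heq] at h
  exact h

theorem integral_sub_div_pow {e t : ℝ} (het : e < t) (m : ℕ) :
    ∫ x in e..t, ((t - x) / (t - e)) ^ m = (t - e) / ((m : ℝ) + 1) := by
  have hne : t - e ≠ 0 := (sub_pos.2 het).ne'
  simp only [div_pow, intervalIntegral.integral_div]
  rw [intervalIntegral.integral_comp_sub_left (fun x => x ^ m) t, integral_pow]
  have hm : (m : ℝ) + 1 ≠ 0 := by positivity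
  field_simp
  simp [pow_succ']

theorem stmt_6
    (n : ℕ) (hn : 2 ≤ n)
    (Δ : Set (ℝ × (Fin (n - 1) → ℝ)))
    (hΔcomp : IsCompact Δ) (hΔconv : Convex ℝ Δ)
    (hΔint : (interior Δ).Nonempty)
    (t₀ t₁ : ℝ) (hproj : Prod.fst '' Δ = Icc t₀ t₁)
    (V : ℝ) (hV : V = (volume Δ).toReal)
    (b₁ : ℝ) (hb₁ : b₁ = (1 / V) * ∫ p in Δ, p.1)
    (g : ℝ → ℝ)
    (hg : ∀ x : ℝ, g x = (volume {y : Fin (n - 1) → ℝ | (x, y) ∈ Δ}).toReal)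
    (e : ℝ) (he : e ∈ Ioo t₀ t₁) :
    (∀ x ∈ Icc e t₁, g e * ((t₁ - x) / (t₁ - e)) ^ (n - 1) ≤ g x)
    ∧ (∫ x in t₀..e, g x) + (t₁ - e) * g e / (n : ℝ) ≤ V := by
  obtain ⟨z, hz⟩ : ∃ z, (t₁, z) ∈ Δ := by
    have h : t₁ ∈ Prod.fst '' Δ := hproj ▸ right_mem_Icc.2 (he.1.trans he.2).le
    simpa using h
  have hslice : ∀ x, volume {y : Fin (n - 1) → ℝ | (x, y) ∈ Δ} ≠ ⊤ := by
    intro x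
    have hsub : {y : Fin (n - 1) → ℝ | (x, y) ∈ Δ} ⊆ Prod.snd '' Δ := fun y hy =>
      ⟨(x, y), hy, rfl⟩
    exact measure_ne_top_of_subset hsub (hΔcomp.image continuous_snd).measure_lt_top.ne
  have hcone : ∀ x ∈ Icc e t₁, g e * ((t₁ - x) / (t₁ - e)) ^ (n - 1) ≤ g x := by
    intro x hx
    have h := ENNReal.toReal_mono (hslice x) (hΔconv.volume_slice_ge_homothety hz he.2 hx)
    rw [ENNReal.toReal_mul, ENNReal.toReal_ofReal, ← hg, ← hg] at h
    · rwa [mul_comm]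
    · exact pow_nonneg (div_nonneg (sub_nonneg.2 hx.2) (sub_nonneg.2 he.2.le)) _
  refine ⟨hcone, ?_⟩
  have hmeas : MeasurableSet Δ := hΔcomp.measurableSet
  have hfin : (volume.prod volume : Measure (ℝ × (Fin (n - 1) → ℝ))) Δ ≠ ⊤ :=
    hΔcomp.measure_lt_top.ne
  have hg' : g = fun x => (volume (Prod.mk x ⁻¹' Δ)).toReal := funext hg
  have hint : Integrable g := by
    rw [hg']
    exact Measure.integrable_measure_prodMk_left hmeas hfin
  have hVint : V = ∫ x, g x := by
    rw [hV, Measure.volume_eq_prod, Measure.prod_apply hmeas, hg', integral_toReal]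
    · exact (measurable_measure_prodMk_left hmeas).aemeasurable
    · exact ae_of_all _ fun x => (hslice x).lt_top
  have hle : ∫ x in t₀..t₁, g x ≤ V := by
    rw [hVint, intervalIntegral.integral_of_le (he.1.trans he.2).le]
    exact setIntegral_le_integral hint (ae_of_all _ fun x => by simp [hg x])
  have hn1 : ((n - 1 : ℕ) : ℝ) + 1 = n := by
    exact_mod_cast Nat.sub_add_cancel (one_le_two.trans hn)
  have hright : (t₁ - e) * g e / (n : ℝ) ≤ ∫ x in e..t₁, g x := by
    calc (t₁ - e) * g e / (n : ℝ)
        = ∫ x in e..t₁, g e * ((t₁ - x) / (t₁ - e)) ^ (n - 1) := by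
          rw [intervalIntegral.integral_const_mul, integral_sub_div_pow he.2, hn1]
          ring
      _ ≤ ∫ x in e..t₁, g x :=
          intervalIntegral.integral_mono_on he.2.le
            (Continuous.intervalIntegrable (by fun_prop) _ _) hint.intervalIntegrable hcone
  have hadd := intervalIntegral.integral_add_adjacent_intervals
    (hint.intervalIntegrable (a := t₀) (b := e)) (hint.intervalIntegrable (a := e) (b := t₁))
  linarith
end
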